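/- arXiv:1606.07504 — 10 statements merged into one kernel-verified Lean document; each statement's English description precedes it below -/
import Mathlib

section
/- Let 0 < α ≤ 1 and a < b. Let f, g : [a,b] → ℝ be left α-differentiable on (a,b) with conformable derivatives f^(α)_a and g^(α)_a, suppose the product f·g is differentiable on [a,b], and suppose the functions x ↦ f(x)·g^(α)_a(x)·(x−a)^{α−1} and x ↦ g(x)·f^(α)_a(x)·(x−a)^{α−1} are integrable on [a,b]. Then ∫_a^b f(x) g^(α)_a(x) (x−a)^{α−1} dx = f(b)g(b) − f(a)g(a) − ∫_a^b g(x) f^(α)_a(x) (x−a)^{α−1} dx. -/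
open Topology Filter MeasureTheory

/-- `f` has left conformable fractional derivative `l` of order `α` starting from `a`,
at the point `x`. -/
def HasConfDerivAt (α a : ℝ) (f : ℝ → ℝ) (l x : ℝ) : Prop :=
  Filter.Tendsto (fun ε : ℝ => (f (x + ε * (x - a) ^ (1 - α)) - f x) / ε)
    (𝓝[≠] (0 : ℝ)) (𝓝 l)

theorem HasConfDerivAt.hasDerivAt {α a l x : ℝ} {f : ℝ → ℝ} (h : HasConfDerivAt α a f l x)
    (hx : a < x) : HasDerivAt f (l * (x - a) ^ (α - 1)) x := by
  have hxa : 0 < x - a := sub_pos.2 hx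
  have hc : 0 < (x - a) ^ (α - 1) := Real.rpow_pos_of_pos hxa _
  have hmul : (x - a) ^ (α - 1) * (x - a) ^ (1 - α) = 1 := by
    rw [← Real.rpow_add hxa]; simp
  rw [hasDerivAt_iff_tendsto_slope_zero]
  have ht : Tendsto (fun t : ℝ => t * (x - a) ^ (α - 1)) (𝓝[≠] 0) (𝓝[≠] 0) := by
    refine tendsto_nhdsWithin_iff.2 ⟨?_, ?_⟩
    · exact ((continuous_mul_const ((x - a) ^ (α - 1))).tendsto' 0 0 (zero_mul _)).mono_left nhdsWithin_le_nhds
    · filter_upwards [self_mem_nhdsWithin] with t ht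
      exact mul_ne_zero ht hc.ne'
  refine ((Tendsto.comp h ht).mul_const ((x - a) ^ (α - 1))).congr' ?_
  filter_upwards [self_mem_nhdsWithin] with t ht
  have ht0 : t ≠ 0 := ht
  simp only [Function.comp_apply, mul_assoc, hmul, mul_one, smul_eq_mul]
  field_simp

/-- Conformable fractional integration by parts:
`∫_a^b f·g^{(α)}_a d^α_a x = f·g|_a^b − ∫_a^b g·f^{(α)}_a d^α_a x`,
where `∫_a^b h d^α_a x = ∫_a^b h(x)(x−a)^{α−1} dx`. -/
theorem conformable_integration_by_parts
    (α a b : ℝ) (hα0 : 0 < α) (hα1 : α ≤ 1) (hab : a < b)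
    (f g fα gα : ℝ → ℝ)
    (hf : ∀ x ∈ Set.Ioo a b, HasConfDerivAt α a f (fα x) x)
    (hg : ∀ x ∈ Set.Ioo a b, HasConfDerivAt α a g (gα x) x)
    (hfg : DifferentiableOn ℝ (fun x => f x * g x) (Set.Icc a b))
    (hint1 : IntervalIntegrable (fun x => f x * gα x * (x - a) ^ (α - 1)) volume a b)
    (hint2 : IntervalIntegrable (fun x => g x * fα x * (x - a) ^ (α - 1)) volume a b) :
    ∫ x in a..b, f x * gα x * (x - a) ^ (α - 1) =
      f b * g b - f a * g a - ∫ x in a..b, g x * fα x * (x - a) ^ (α - 1) := by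
  rw [eq_sub_iff_add_eq, ← intervalIntegral.integral_add hint1 hint2]
  refine intervalIntegral.integral_eq_sub_of_hasDerivAt_of_le (f := fun x => f x * g x) hab.le
    hfg.continuousOn (fun x hx => ?_) (hint1.add hint2)
  refine (((hf x hx).hasDerivAt hx.1).mul ((hg x hx).hasDerivAt hx.1)).congr_deriv ?_
  ring
end

section
/- Let 0 < α ≤ 1, a ∈ ℝ, N ∈ ℕ, let f : ℝ^N → ℝ be differentiable, and let y_1, …, y_N : ℝ → ℝ each be left α-differentiable at a point x > a with conformable derivatives (y_i)^(α)_a(x). Then the composite function F(x) = f(y_1(x), …, y_N(x)) is left α-differentiable at x and F^(α)_a(x) = Σ_{i=1}^N (∂f/∂y_i)(y_1(x),…,y_N(x)) · (y_i)^(α)_a(x). -/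
open Topology Filter

/-- The conformable derivative is the ordinary derivative at `0` along the line
`ε ↦ x + ε * (x - a) ^ (1 - α)`. -/
theorem hasConfDerivAt_iff_hasDerivAt {α a : ℝ} {f : ℝ → ℝ} {l x : ℝ} :
    HasConfDerivAt α a f l x ↔ HasDerivAt (fun ε : ℝ => f (x + ε * (x - a) ^ (1 - α))) l 0 := by
  simp [HasConfDerivAt, hasDerivAt_iff_tendsto_slope_zero, div_eq_inv_mul]

/-- Conformable chain rule for functions of several variables: if `f : ℝ^N → ℝ` is
differentiable and each `yᵢ` is left `α`-differentiable at `x > a` with conformable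
derivative `d i`, then `x ↦ f(y₁(x),…,y_N(x))` is left `α`-differentiable at `x` with
conformable derivative `Σᵢ (∂f/∂yᵢ)(y(x))·(yᵢ)^{(α)}_a(x)`. -/
theorem conformable_chain_rule_several_variables
    (α a : ℝ) (hα0 : 0 < α) (hα1 : α ≤ 1) (N : ℕ)
    (f : (Fin N → ℝ) → ℝ) (hf : Differentiable ℝ f)
    (y : Fin N → ℝ → ℝ) (d : Fin N → ℝ) (x : ℝ) (hx : a < x)
    (hy : ∀ i, HasConfDerivAt α a (y i) (d i) x) :
    HasConfDerivAt α a (fun t => f (fun i => y i t))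
      (∑ i, fderiv ℝ f (fun i => y i x) (Pi.single i 1) * d i) x := by
  simp only [hasConfDerivAt_iff_hasDerivAt] at hy ⊢
  refine ((hf _).hasFDerivAt.comp_hasDerivAt (0 : ℝ) (hasDerivAt_pi.2 hy)).congr_deriv ?_
  simp only [zero_mul, add_zero]
  conv_lhs => rw [pi_eq_sum_univ' d, map_sum]
  refine Finset.sum_congr rfl fun i _ => ?_
  rw [map_smul, smul_eq_mul, mul_comm]
end

section
/- Fundamental Lemma of the conformable calculus of variations: let 0 < α ≤ 1, a < b, and let M : [a,b] → ℝ be continuous. If ∫_a^b η(x) M(x) (x−a)^{α−1} dx = 0 for every continuous function η : [a,b] → ℝ with η(a) = η(b) = 0, then M(x) = 0 for all x ∈ [a,b]. -/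
open MeasureTheory

/-- Fundamental Lemma of the conformable calculus of variations: if `M` is continuous
on `[a,b]` and `∫_a^b η(x)M(x)(x−a)^{α−1} dx = 0` for every continuous `η` vanishing
at `a` and `b`, then `M ≡ 0` on `[a,b]`. -/
theorem conformable_fundamental_lemma
    (α a b : ℝ) (hα0 : 0 < α) (hα1 : α ≤ 1) (hab : a < b)
    (M : ℝ → ℝ) (hM : ContinuousOn M (Set.Icc a b))
    (h : ∀ η : ℝ → ℝ, ContinuousOn η (Set.Icc a b) → η a = 0 → η b = 0 →
      ∫ x in a..b, η x * M x * (x - a) ^ (α - 1) = 0) :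
    ∀ x ∈ Set.Icc a b, M x = 0 := by
  have interior_zero : Set.EqOn M 0 (Set.Ioo a b) := by
    intro c hc
    by_contra hMc
    have hη := h (fun x => (x - a) * (b - x) * M x) (by fun_prop) (by simp) (by simp)
    have hcongr : ∫ x in a..b, (x - a) * (b - x) * M x * M x * (x - a) ^ (α - 1) =
        ∫ x in a..b, (x - a) ^ α * ((b - x) * M x ^ 2) := by
      refine intervalIntegral.integral_congr_uIoo fun x hx => ?_
      rw [Set.uIoo_of_lt hab] at hx
      have hxa : x - a ≠ 0 := (sub_pos.2 hx.1).ne'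
      simp only [Real.rpow_sub_one hxa]
      field_simp
    have hcont : ContinuousOn (fun x => (x - a) ^ α * ((b - x) * M x ^ 2)) (Set.Icc a b) :=
      ((by fun_prop : ContinuousOn (fun x => x - a) (Set.Icc a b)).rpow_const
        fun _ _ => Or.inr hα0.le).mul (by fun_prop)
    refine (intervalIntegral.integral_pos hab hcont (fun x hx => ?_)
      ⟨c, Set.Ioo_subset_Icc_self hc, ?_⟩).ne' (hcongr.symm.trans hη)
    · exact mul_nonneg (Real.rpow_nonneg (sub_nonneg.2 hx.1.le) _)
        (mul_nonneg (sub_nonneg.2 hx.2) (sq_nonneg _))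
    · exact mul_pos (Real.rpow_pos_of_pos (sub_pos.2 hc.1) _)
        (mul_pos (sub_pos.2 hc.2) (sq_pos_of_ne_zero hMc))
  exact interior_zero.of_subset_closure hM continuousOn_const Set.Ioo_subset_Icc_self
    (closure_Ioo hab.ne).ge
end

section
/- Conformable fractional DuBois–Reymond condition: let 0 < α ≤ 1, a < b, and L : [a,b]×ℝ×ℝ → ℝ be of class C¹. Let y : [a,b] → ℝ be left α-differentiable with conformable derivative y^(α)_a, assume y^(α)_a is itself left α-differentiable on (a,b), and assume p(x) = (∂L/∂v)(x,y(x),y^(α)_a(x)) is left α-differentiable on (a,b). If y satisfies the Euler–Lagrange equation (∂L/∂y)(x,y(x),y^(α)_a(x)) − p^(α)_a(x) = 0 on (a,b), then for all x ∈ (a,b): (d^α_a/dx^α)[ L(x,y(x),y^(α)_a(x)) − p(x)·y^(α)_a(x) ] = (∂L/∂x)(x,y(x),y^(α)_a(x)) · (x−a)^{1−α}. -/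
open Topology Filter

/-- The derivative of a function of three real variables along a curve, in terms of its
partial derivatives. -/
theorem DifferentiableAt.hasDerivAt_comp_three {L : ℝ → ℝ → ℝ → ℝ} {f g h : ℝ → ℝ}
    {f' g' h' t : ℝ}
    (hL : DifferentiableAt ℝ (fun q : ℝ × ℝ × ℝ => L q.1 q.2.1 q.2.2) (f t, g t, h t))
    (hf : HasDerivAt f f' t) (hg : HasDerivAt g g' t) (hh : HasDerivAt h h' t) :
    HasDerivAt (fun s => L (f s) (g s) (h s))
      (deriv (fun s => L s (g t) (h t)) (f t) * f' + deriv (fun u => L (f t) u (h t)) (g t) * g'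
        + deriv (fun v => L (f t) (g t) v) (h t) * h') t := by
  have hF := hL.hasFDerivAt
  set D := fderiv ℝ (fun q : ℝ × ℝ × ℝ => L q.1 q.2.1 q.2.2) (f t, g t, h t)
  have hcomp {u v w : ℝ → ℝ} {u' v' w' s : ℝ} (hu : HasDerivAt u u' s) (hv : HasDerivAt v v' s)
      (hw : HasDerivAt w w' s) (heq : (f t, g t, h t) = (u s, v s, w s)) :
      HasDerivAt (fun r => L (u r) (v r) (w r)) (D (u', v', w')) s :=
    hF.comp_hasDerivAt_of_eq (l := fun q : ℝ × ℝ × ℝ => L q.1 q.2.1 q.2.2)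
      s (hu.prodMk (hv.prodMk hw)) heq
  have h₁ := hcomp (hasDerivAt_id' (f t)) (hasDerivAt_const _ (g t)) (hasDerivAt_const _ (h t)) rfl
  have h₂ := hcomp (hasDerivAt_const _ (f t)) (hasDerivAt_id' (g t)) (hasDerivAt_const _ (h t)) rfl
  have h₃ := hcomp (hasDerivAt_const _ (f t)) (hasDerivAt_const _ (g t)) (hasDerivAt_id' (h t)) rfl
  rw [h₁.deriv, h₂.deriv, h₃.deriv]
  refine (hcomp hf hg hh rfl).congr_deriv ?_
  have hsplit : ((f', g', h') : ℝ × ℝ × ℝ) =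
      f' • (1, 0, 0) + g' • (0, 1, 0) + h' • (0, 0, 1) := by simp
  rw [hsplit]
  simp only [map_add, map_smul, smul_eq_mul]
  ring

/-- The conformable fractional DuBois–Reymond condition: along a solution of the
conformable Euler–Lagrange equation,
`(d^α_a/dx^α)[L − (∂L/∂v)·y^{(α)}_a] = (∂L/∂x)·(x−a)^{1−α}` on `(a,b)`. -/
theorem conformable_duBois_Reymond
    (α a b : ℝ) (hα0 : 0 < α) (hα1 : α ≤ 1) (hab : a < b)
    (L : ℝ → ℝ → ℝ → ℝ)
    (hL : ContDiff ℝ 1 (fun q : ℝ × ℝ × ℝ => L q.1 q.2.1 q.2.2))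
    (y yα yαα p pα : ℝ → ℝ)
    (hy : ∀ x ∈ Set.Icc a b, HasConfDerivAt α a y (yα x) x)
    (hyα : ∀ x ∈ Set.Ioo a b, HasConfDerivAt α a yα (yαα x) x)
    (hpdef : ∀ x, p x = deriv (fun v => L x (y x) v) (yα x))
    (hpα : ∀ x ∈ Set.Ioo a b, HasConfDerivAt α a p (pα x) x)
    (hEL : ∀ x ∈ Set.Ioo a b, deriv (fun u => L x u (yα x)) (y x) - pα x = 0) :
    ∀ x ∈ Set.Ioo a b,
      HasConfDerivAt α a (fun t => L t (y t) (yα t) - p t * yα t)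
        (deriv (fun t => L t (y x) (yα x)) x * (x - a) ^ (1 - α)) x := by
  intro x hx
  have hid : HasDerivAt (fun ε : ℝ => x + ε * (x - a) ^ (1 - α)) ((x - a) ^ (1 - α)) 0 := by
    simpa using ((hasDerivAt_id (0 : ℝ)).mul_const ((x - a) ^ (1 - α))).const_add x
  have hY := hasConfDerivAt_iff_hasDerivAt.1 (hy x (Set.Ioo_subset_Icc_self hx))
  have hV := hasConfDerivAt_iff_hasDerivAt.1 (hyα x hx)
  have hP := hasConfDerivAt_iff_hasDerivAt.1 (hpα x hx)
  have hLcurve := DifferentiableAt.hasDerivAt_comp_three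
    ((hL.differentiable one_ne_zero) _) hid hY hV
  rw [hasConfDerivAt_iff_hasDerivAt]
  refine (hLcurve.sub (hP.mul hV)).congr_deriv ?_
  simp only [zero_mul, add_zero]
  rw [← hpdef x, sub_eq_zero.1 (hEL x hx)]
  ring
end

section
/- Necessary condition of invariance: let 0 < α < 1, a < b, L : [a,b]×ℝ×ℝ → ℝ be of class C¹, and y : [a,b] → ℝ be left α-differentiable with conformable derivative y^(α)_a. Let T, X, G : [a,b] → ℝ (the values τ(x,y(x)), ξ(x,y(x)), Λ(x,y(x)) of the generators and the Gauge term along y) be left α-differentiable with conformable derivatives T^(α)_a, X^(α)_a, G^(α)_a. Fix x ∈ (a,b) and suppose the invariance identity holds at x: the function Φ(ε) = L( x+εT(x), y(x)+εX(x), (y^(α)_a(x)+εX^(α)_a(x))·(x+εT(x)−a)^{1−α}/((x−a)^{1−α}+εT^(α)_a(x)) ) · (1 + εT^(α)_a(x)/(x−a)^{1−α}) satisfies Φ(ε) = Φ(0) + ε·G^(α)_a(x) + o(ε) as ε → 0. Then, with all partial derivatives of L evaluated at (x, y(x), y^(α)_a(x)): (∂L/∂x)·T(x) + (∂L/∂y)·X(x)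 + (∂L/∂v)·[ X^(α)_a(x) − y^(α)_a(x)·( (α−1)T(x)/(x−a) + T^(α)_a(x)/(x−a)^{1−α} ) ] + L·T^(α)_a(x)/(x−a)^{1−α} = G^(α)_a(x). -/
open Topology Filter

/-- Derivative at `0` of the conformable velocity of the transformed curve. -/
theorem hasDerivAt_transformed_velocity {α a x : ℝ} (hxa : 0 < x - a) (v w T T' : ℝ) :
    HasDerivAt (fun ε : ℝ => (v + ε * w) * (x + ε * T - a) ^ (1 - α) /
        ((x - a) ^ (1 - α) + ε * T'))
      (w - v * ((α - 1) * T / (x - a) + T' / (x - a) ^ (1 - α))) 0 := by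
  have hP : (x - a) ^ (1 - α) ≠ 0 := (Real.rpow_pos_of_pos hxa _).ne'
  have line (c d : ℝ) : HasDerivAt (fun ε : ℝ => c + ε * d) d 0 := by
    simpa using ((hasDerivAt_id (0 : ℝ)).mul_const d).const_add c
  have hpow : HasDerivAt (fun ε : ℝ => (x + ε * T - a) ^ (1 - α))
      (T * (1 - α) * (x + 0 * T - a) ^ (1 - α - 1)) 0 :=
    ((line x T).sub_const a).rpow_const (Or.inl (by simpa using hxa.ne'))
  have h := ((line v w).mul hpow).div (line ((x - a) ^ (1 - α)) T') (by simpa using hP)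
  refine h.congr_deriv ?_
  simp only [zero_mul, add_zero, Pi.mul_apply]
  rw [Real.rpow_sub_one hxa.ne']
  have := hxa.ne'
  field_simp
  ring

/-- Chain rule along a curve for a function of three real variables, in terms of its partial
derivatives. -/
theorem hasDerivAt_comp_three_partials {L : ℝ → ℝ → ℝ → ℝ} {f g h : ℝ → ℝ} {f' g' h' t : ℝ}
    (hL : DifferentiableAt ℝ (fun q : ℝ × ℝ × ℝ => L q.1 q.2.1 q.2.2) (f t, g t, h t))
    (hf : HasDerivAt f f' t) (hg : HasDerivAt g g' t) (hh : HasDerivAt h h' t) :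
    HasDerivAt (fun s => L (f s) (g s) (h s))
      (deriv (fun u => L u (g t) (h t)) (f t) * f' + deriv (fun u => L (f t) u (h t)) (g t) * g' +
        deriv (fun u => L (f t) (g t) u) (h t) * h') t := by
  obtain ⟨D, hD⟩ := hL
  have h1 : HasDerivAt (fun u => L u (g t) (h t)) (D (1, 0, 0)) (f t) :=
    HasFDerivAt.comp_hasDerivAt (f := fun u => (u, g t, h t)) (f t) hD
      ((hasDerivAt_id (f t)).prodMk
      ((hasDerivAt_const (f t) (g t)).prodMk (hasDerivAt_const (f t) (h t))))
  have h2 : HasDerivAt (fun u => L (f t) u (h t)) (D (0, 1, 0)) (g t) :=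
    HasFDerivAt.comp_hasDerivAt (f := fun u => (f t, u, h t)) (g t) hD
      ((hasDerivAt_const (g t) (f t)).prodMk
      ((hasDerivAt_id (g t)).prodMk (hasDerivAt_const (g t) (h t))))
  have h3 : HasDerivAt (fun u => L (f t) (g t) u) (D (0, 0, 1)) (h t) :=
    HasFDerivAt.comp_hasDerivAt (f := fun u => (f t, g t, u)) (h t) hD
      ((hasDerivAt_const (h t) (f t)).prodMk
      ((hasDerivAt_const (h t) (g t)).prodMk (hasDerivAt_id (h t))))
  have hc : HasDerivAt (fun s => L (f s) (g s) (h s)) (D (f', g', h')) t :=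
    HasFDerivAt.comp_hasDerivAt (f := fun s => (f s, g s, h s)) t hD (hf.prodMk (hg.prodMk hh))
  rw [h1.deriv, h2.deriv, h3.deriv]
  refine hc.congr_deriv ?_
  have hdecomp : ((f', g', h') : ℝ × ℝ × ℝ) =
      f' • (1, 0, 0) + g' • (0, 1, 0) + h' • (0, 0, 1) := by simp
  rw [hdecomp, map_add, map_add, map_smul, map_smul, map_smul]
  simp only [smul_eq_mul]
  ring

/-- Necessary condition of invariance: if the conformable variational functional is
invariant (up to a Gauge term) under the one-parameter family of transformations
`x̄ = x + ετ`, `ȳ = y + εξ` at the point `x` (invariance identity up to `o(ε)`,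
expressed as a derivative-at-`0` condition on `Φ`), then
`(∂L/∂x)τ + (∂L/∂y)ξ + (∂L/∂v)[ξ^{(α)}_a − y^{(α)}_a((α−1)τ/(x−a) + τ^{(α)}_a/(x−a)^{1−α})]
 + L·τ^{(α)}_a/(x−a)^{1−α} = Λ^{(α)}_a`. -/
theorem conformable_invariance_necessary_condition
    (α a b : ℝ) (hα0 : 0 < α) (hα1 : α < 1) (hab : a < b)
    (L : ℝ → ℝ → ℝ → ℝ)
    (hL : ContDiff ℝ 1 (fun q : ℝ × ℝ × ℝ => L q.1 q.2.1 q.2.2))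
    (y yα T Tα X Xα G Gα : ℝ → ℝ)
    (hy : ∀ t ∈ Set.Icc a b, HasConfDerivAt α a y (yα t) t)
    (hT : ∀ t ∈ Set.Ioo a b, HasConfDerivAt α a T (Tα t) t)
    (hX : ∀ t ∈ Set.Ioo a b, HasConfDerivAt α a X (Xα t) t)
    (hG : ∀ t ∈ Set.Ioo a b, HasConfDerivAt α a G (Gα t) t)
    (x : ℝ) (hx : x ∈ Set.Ioo a b)
    (hinv : HasDerivAt (fun ε : ℝ =>
      L (x + ε * T x) (y x + ε * X x)
          ((yα x + ε * Xα x) * (x + ε * T x - a) ^ (1 - α) /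
            ((x - a) ^ (1 - α) + ε * Tα x)) *
        (1 + ε * Tα x / (x - a) ^ (1 - α))) (Gα x) 0) :
    deriv (fun t => L t (y x) (yα x)) x * T x
      + deriv (fun u => L x u (yα x)) (y x) * X x
      + deriv (fun v => L x (y x) v) (yα x) *
          (Xα x - yα x * ((α - 1) * T x / (x - a) + Tα x / (x - a) ^ (1 - α)))
      + L x (y x) (yα x) * Tα x / (x - a) ^ (1 - α) = Gα x := by
  have hxa : 0 < x - a := sub_pos.2 hx.1
  have hP : (x - a) ^ (1 - α) ≠ 0 := (Real.rpow_pos_of_pos hxa _).ne'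
  have line (c d : ℝ) : HasDerivAt (fun ε : ℝ => c + ε * d) d 0 := by
    simpa using ((hasDerivAt_id (0 : ℝ)).mul_const d).const_add c
  have hLag := hasDerivAt_comp_three_partials (hL.differentiable one_ne_zero _) (line x (T x))
    (line (y x) (X x)) (hasDerivAt_transformed_velocity (α := α) hxa (yα x) (Xα x) (T x) (Tα x))
  have hJac : HasDerivAt (fun ε : ℝ => 1 + ε * Tα x / (x - a) ^ (1 - α))
      (Tα x / (x - a) ^ (1 - α)) 0 := by
    simpa only [mul_div_assoc] using line 1 (Tα x / (x - a) ^ (1 - α))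
  have key := (hLag.mul hJac).unique hinv
  simp only [zero_mul, add_zero, zero_div, mul_one, mul_div_cancel_right₀ _ hP] at key
  rw [← key]
  ring
end

section
/- Let 0 < α < 1, a < b, L : [a,b]×ℝ×ℝ → ℝ be of class C¹, and y : [a,b] → ℝ be left α-differentiable with conformable derivative y^(α)_a such that p(x) = (∂L/∂v)(x,y(x),y^(α)_a(x)) is left α-differentiable on (a,b). Let X, G : [a,b] → ℝ be left α-differentiable with conformable derivatives X^(α)_a, G^(α)_a and assume x ↦ p(x)X(x) is left α-differentiable. Assume y is an extremal, i.e. (∂L/∂y)(x,y,y^(α)_a) − p^(α)_a = 0 on (a,b), and assume the invariance condition under the transformation x̄ = x, ȳ = y + εξ holds on (a,b): (∂L/∂y)·X + (∂L/∂v)·X^(α)_a = G^(α)_a, with partials of L evaluated at (x,y(x),y^(α)_a(x)). Then (d^α_a/dx^α)[ p(x)·X(x) − G(x) ] = 0 on (a,b); i.e. p·X − G is a conserved quantity. -/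
open Topology Filter

theorem HasConfDerivAt.mul {α a : ℝ} {f g : ℝ → ℝ} {l m x : ℝ}
    (hf : HasConfDerivAt α a f l x) (hg : HasConfDerivAt α a g m x) :
    HasConfDerivAt α a (fun t => f t * g t) (l * g x + f x * m) x := by
  rw [hasConfDerivAt_iff_hasDerivAt] at hf hg ⊢
  simpa using hf.fun_mul hg

theorem HasConfDerivAt.sub {α a : ℝ} {f g : ℝ → ℝ} {l m x : ℝ}
    (hf : HasConfDerivAt α a f l x) (hg : HasConfDerivAt α a g m x) :
    HasConfDerivAt α a (fun t => f t - g t) (l - m) x := by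
  rw [hasConfDerivAt_iff_hasDerivAt] at hf hg ⊢
  exact hf.fun_sub hg

/-- If `y` is an extremal and the functional is invariant under `x̄ = x`, `ȳ = y + εξ`
up to the Gauge term `Λ` (necessary invariance condition
`(∂L/∂y)ξ + (∂L/∂v)ξ^{(α)}_a = Λ^{(α)}_a`), then `p·ξ − Λ` is a conserved quantity:
its conformable derivative vanishes on `(a,b)`. Here `p = ∂L/∂v` and `X, G` denote
`ξ, Λ` evaluated along `y`. -/
theorem conformable_noether_time_independent
    (α a b : ℝ) (hα0 : 0 < α) (hα1 : α < 1) (hab : a < b)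
    (L : ℝ → ℝ → ℝ → ℝ)
    (hL : ContDiff ℝ 1 (fun q : ℝ × ℝ × ℝ => L q.1 q.2.1 q.2.2))
    (y yα p pα X Xα G Gα : ℝ → ℝ)
    (hy : ∀ x ∈ Set.Icc a b, HasConfDerivAt α a y (yα x) x)
    (hpdef : ∀ x, p x = deriv (fun v => L x (y x) v) (yα x))
    (hp : ∀ x ∈ Set.Ioo a b, HasConfDerivAt α a p (pα x) x)
    (hX : ∀ x ∈ Set.Ioo a b, HasConfDerivAt α a X (Xα x) x)
    (hG : ∀ x ∈ Set.Ioo a b, HasConfDerivAt α a G (Gα x) x)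
    (hpX : ∀ x ∈ Set.Ioo a b, ∃ l, HasConfDerivAt α a (fun t => p t * X t) l x)
    (hEL : ∀ x ∈ Set.Ioo a b, deriv (fun u => L x u (yα x)) (y x) - pα x = 0)
    (hinv : ∀ x ∈ Set.Ioo a b,
      deriv (fun u => L x u (yα x)) (y x) * X x
        + deriv (fun v => L x (y x) v) (yα x) * Xα x = Gα x) :
    ∀ x ∈ Set.Ioo a b,
      HasConfDerivAt α a (fun t => p t * X t - G t) 0 x := by
  intro x hx
  convert ((hp x hx).mul (hX x hx)).sub (hG x hx) using 1
  rw [← hinv x hx, ← hpdef x, sub_eq_zero.mp (hEL x hx)]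
  ring
end

section
/- Conformable Green's theorem for a rectangle: let 0 < α ≤ 1, a < b, c < d, R = [a,b]×[c,d], and let f, g : R → ℝ be continuously differentiable. Then ∫_a^b ( f(x₁,c) − f(x₁,d) ) (x₁−a)^{α−1} dx₁ + ∫_c^d ( g(b,x₂) − g(a,x₂) ) (x₂−c)^{α−1} dx₂ = ∫_a^b ∫_c^d [ (x₁−a)^{1−α}(∂g/∂x₁)(x₁,x₂) − (x₂−c)^{1−α}(∂f/∂x₂)(x₁,x₂) ] (x₂−c)^{α−1} (x₁−a)^{α−1} dx₂ dx₁. -/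
open MeasureTheory

/-- The conformable weight `(x - a) ^ (α - 1)` is integrable on every interval when `0 < α`. -/
lemma intervalIntegrable_conformable_weight {α : ℝ} (hα : 0 < α) (a p q : ℝ) :
    IntervalIntegrable (fun x => (x - a) ^ (α - 1)) volume p q := by
  simpa using (intervalIntegral.intervalIntegrable_rpow' (a := p - a) (b := q - a)
    (r := α - 1) (by linarith)).comp_sub_right a

/-- For `x > a`, the factor of the conformable derivative cancels the conformable weight. -/
lemma conformable_factor_mul_weight {α a x : ℝ} (h : a < x) :
    (x - a) ^ (1 - α) * (x - a) ^ (α - 1) = 1 := by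
  rw [← Real.rpow_add (sub_pos.2 h)]
  simp

/-- A function continuous on a closed rectangle, times a weight in the second variable, is
integrable on the half-open rectangle. -/
lemma integrableOn_prod_mul_weight {a b c d : ℝ} (hcd : c ≤ d) {u : ℝ → ℝ → ℝ} {w : ℝ → ℝ}
    (hu : ContinuousOn (fun q : ℝ × ℝ => u q.1 q.2) (Set.Icc a b ×ˢ Set.Icc c d))
    (hw : IntervalIntegrable w volume c d) :
    IntegrableOn (fun q : ℝ × ℝ => u q.1 q.2 * w q.2) (Set.Ioc a b ×ˢ Set.Ioc c d) := by
  have hw' : IntegrableOn (fun q : ℝ × ℝ => w q.2) (Set.Ioc a b ×ˢ Set.Ioc c d) := by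
    rw [IntegrableOn, Measure.volume_eq_prod, ← Measure.prod_restrict]
    simpa using (integrable_const (1 : ℝ) (μ := volume.restrict (Set.Ioc a b))).mul_prod
      ((intervalIntegrable_iff_integrableOn_Ioc_of_le hcd).1 hw)
  exact IntegrableOn.continuousOn_mul_of_subset hu hw' (isCompact_Icc.prod isCompact_Icc)
    (measurableSet_Ioc.prod measurableSet_Ioc)
    (Set.prod_mono Set.Ioc_subset_Icc_self Set.Ioc_subset_Icc_self)

/-- The conformable Green's theorem for a rectangle `R = [a,b]×[c,d]`: for continuously
differentiable `f, g` (partial derivatives `f₁ = ∂f/∂x₁`, `f₂ = ∂f/∂x₂`, `g₁ = ∂g/∂x₁`,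
`g₂ = ∂g/∂x₂`, all continuous on `R`),
`∫_a^b (f(x₁,c) − f(x₁,d)) d^α_a x₁ + ∫_c^d (g(b,x₂) − g(a,x₂)) d^α_c x₂
  = ∫_R (∂^α_a g/∂x₁^α − ∂^α_c f/∂x₂^α) d^α_a x₁ d^α_c x₂`,
with `∂^α_a g/∂x₁^α = (x₁−a)^{1−α} g₁` and `∂^α_c f/∂x₂^α = (x₂−c)^{1−α} f₂`, the
conformable integrals carrying the weights `(x₁−a)^{α−1}` and `(x₂−c)^{α−1}`. -/
theorem conformable_green_theorem
    (α a b c d : ℝ) (hα0 : 0 < α) (hα1 : α ≤ 1) (hab : a < b) (hcd : c < d)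
    (f g f₁ f₂ g₁ g₂ : ℝ → ℝ → ℝ)
    (hf₁ : ∀ x₁ ∈ Set.Icc a b, ∀ x₂ ∈ Set.Icc c d,
      HasDerivAt (fun t => f t x₂) (f₁ x₁ x₂) x₁)
    (hf₂ : ∀ x₁ ∈ Set.Icc a b, ∀ x₂ ∈ Set.Icc c d,
      HasDerivAt (fun t => f x₁ t) (f₂ x₁ x₂) x₂)
    (hg₁ : ∀ x₁ ∈ Set.Icc a b, ∀ x₂ ∈ Set.Icc c d,
      HasDerivAt (fun t => g t x₂) (g₁ x₁ x₂) x₁)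
    (hg₂ : ∀ x₁ ∈ Set.Icc a b, ∀ x₂ ∈ Set.Icc c d,
      HasDerivAt (fun t => g x₁ t) (g₂ x₁ x₂) x₂)
    (hfc : ContinuousOn (fun q : ℝ × ℝ => f q.1 q.2) (Set.Icc a b ×ˢ Set.Icc c d))
    (hgc : ContinuousOn (fun q : ℝ × ℝ => g q.1 q.2) (Set.Icc a b ×ˢ Set.Icc c d))
    (hf₁c : ContinuousOn (fun q : ℝ × ℝ => f₁ q.1 q.2) (Set.Icc a b ×ˢ Set.Icc c d))
    (hf₂c : ContinuousOn (fun q : ℝ × ℝ => f₂ q.1 q.2) (Set.Icc a b ×ˢ Set.Icc c d))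
    (hg₁c : ContinuousOn (fun q : ℝ × ℝ => g₁ q.1 q.2) (Set.Icc a b ×ˢ Set.Icc c d))
    (hg₂c : ContinuousOn (fun q : ℝ × ℝ => g₂ q.1 q.2) (Set.Icc a b ×ˢ Set.Icc c d)) :
    (∫ x₁ in a..b, (f x₁ c - f x₁ d) * (x₁ - a) ^ (α - 1))
      + (∫ x₂ in c..d, (g b x₂ - g a x₂) * (x₂ - c) ^ (α - 1)) =
    ∫ x₁ in a..b, ∫ x₂ in c..d,
      ((x₁ - a) ^ (1 - α) * g₁ x₁ x₂ - (x₂ - c) ^ (1 - α) * f₂ x₁ x₂)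
        * (x₂ - c) ^ (α - 1) * (x₁ - a) ^ (α - 1) := by
  have hw₁ := intervalIntegrable_conformable_weight hα0 a a b
  have hw₂ := intervalIntegrable_conformable_weight hα0 c c d
  have hG := integrableOn_prod_mul_weight hcd.le hg₁c hw₂
  have row {u : ℝ → ℝ → ℝ}
      (hu : ContinuousOn (fun q : ℝ × ℝ => u q.1 q.2) (Set.Icc a b ×ˢ Set.Icc c d))
      {x : ℝ} (hx : x ∈ Set.Icc a b) : ContinuousOn (u x) (Set.uIcc c d) := by
    rw [Set.uIcc_of_le hcd.le]
    exact hu.comp (f := fun y => (x, y)) (by fun_prop) fun y hy => ⟨hx, hy⟩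
  have col {u : ℝ → ℝ → ℝ}
      (hu : ContinuousOn (fun q : ℝ × ℝ => u q.1 q.2) (Set.Icc a b ×ˢ Set.Icc c d))
      {y : ℝ} (hy : y ∈ Set.Icc c d) : ContinuousOn (fun x => u x y) (Set.uIcc a b) := by
    rw [Set.uIcc_of_le hab.le]
    exact hu.comp (f := fun x => (x, y)) (by fun_prop) fun x hx => ⟨hx, hy⟩
  have inner : ∀ x ∈ Set.Ioc a b, (∫ y in c..d,
      ((x - a) ^ (1 - α) * g₁ x y - (y - c) ^ (1 - α) * f₂ x y)
        * (y - c) ^ (α - 1) * (x - a) ^ (α - 1)) =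
      (∫ y in c..d, g₁ x y * (y - c) ^ (α - 1)) + (f x c - f x d) * (x - a) ^ (α - 1) := by
    intro x hx
    have hx' := Set.Ioc_subset_Icc_self hx
    have ftc : ∫ y in c..d, f₂ x y = f x d - f x c :=
      intervalIntegral.integral_eq_sub_of_hasDerivAt
        (fun y hy => hf₂ x hx' y (by rwa [Set.uIcc_of_le hcd.le] at hy))
        (row hf₂c hx').intervalIntegrable
    calc
      _ = ∫ y in c..d, (g₁ x y * (y - c) ^ (α - 1) - f₂ x y * (x - a) ^ (α - 1)) := by
        refine intervalIntegral.integral_congr_ae (.of_forall fun y hy => ?_)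
        rw [Set.uIoc_of_le hcd.le] at hy
        linear_combination
          g₁ x y * (y - c) ^ (α - 1) * conformable_factor_mul_weight (α := α) hx.1
            - f₂ x y * (x - a) ^ (α - 1) * conformable_factor_mul_weight (α := α) hy.1
      _ = _ := by
        rw [intervalIntegral.integral_sub (hw₂.continuousOn_mul (row hg₁c hx'))
          ((row hf₂c hx').intervalIntegrable.mul_const _),
          intervalIntegral.integral_mul_const, ftc]
        ring
  have outer : (∫ x in a..b, ∫ y in c..d, g₁ x y * (y - c) ^ (α - 1)) =
      ∫ y in c..d, (g b y - g a y) * (y - c) ^ (α - 1) := by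
    rw [intervalIntegral_intervalIntegral_swap
      (by rw [Set.uIoc_of_le hab.le, Set.uIoc_of_le hcd.le]; exact hG)]
    refine intervalIntegral.integral_congr fun y hy => ?_
    rw [Set.uIcc_of_le hcd.le] at hy
    simp only [intervalIntegral.integral_mul_const]
    rw [intervalIntegral.integral_eq_sub_of_hasDerivAt
      (fun x hx => hg₁ x (by rwa [Set.uIcc_of_le hab.le] at hx) y hy)
      (col hg₁c hy).intervalIntegrable]
  have hGint : IntervalIntegrable (fun x => ∫ y in c..d, g₁ x y * (y - c) ^ (α - 1))
      volume a b := by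
    rw [intervalIntegrable_iff_integrableOn_Ioc_of_le hab.le]
    simp only [intervalIntegral.integral_of_le hcd.le]
    rw [IntegrableOn, Measure.volume_eq_prod, ← Measure.prod_restrict] at hG
    exact hG.integral_prod_left
  have hFint : IntervalIntegrable (fun x => (f x c - f x d) * (x - a) ^ (α - 1))
      volume a b :=
    hw₁.continuousOn_mul ((col hfc (Set.left_mem_Icc.2 hcd.le)).sub
      (col hfc (Set.right_mem_Icc.2 hcd.le)))
  rw [intervalIntegral.integral_congr_ae (.of_forall fun x hx => inner x
    (by rwa [Set.uIoc_of_le hab.le] at hx)), intervalIntegral.integral_add hGint hFint, outer,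
    add_comm]
end

section
/- Let 0 < α ≤ 1, a < b, c < d, R = [a,b]×[c,d], and let F, G, h : R → ℝ be continuously differentiable with h = 0 on the boundary ∂R of R. Then ∫_a^b ∫_c^d [ G(x₁,x₂)·(x₁−a)^{1−α}(∂h/∂x₁)(x₁,x₂) − F(x₁,x₂)·(x₂−c)^{1−α}(∂h/∂x₂)(x₁,x₂) ] (x₂−c)^{α−1}(x₁−a)^{α−1} dx₂ dx₁ = −∫_a^b ∫_c^d [ (x₁−a)^{1−α}(∂G/∂x₁)(x₁,x₂) − (x₂−c)^{1−α}(∂F/∂x₂)(x₁,x₂) ]·h(x₁,x₂)·(x₂−c)^{α−1}(x₁−a)^{α−1} dx₂ dx₁. -/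
open MeasureTheory

/-- The weight `(x - a) ^ (α - 1)` of the conformable integral is integrable for `α > 0`. -/
theorem integrable_conformable_weight {α : ℝ} (hα : 0 < α) {a b : ℝ} (hab : a ≤ b) :
    Integrable (fun x : ℝ => (x - a) ^ (α - 1)) (volume.restrict (Set.Ioc a b)) := by
  have h : IntervalIntegrable (fun x : ℝ => x ^ (α - 1)) volume (a - a) (b - a) :=
    intervalIntegral.intervalIntegrable_rpow' (by linarith)
  have h' := h.comp_sub_right a
  simp only [sub_add_cancel] at h'
  exact (intervalIntegrable_iff_integrableOn_Ioc_of_le hab).1 h'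

/-- A continuous function on a closed rectangle is a bounded multiplier of integrable functions. -/
theorem ContinuousOn.integrable_mul_of_rectangle {a b c d : ℝ} {K w : ℝ × ℝ → ℝ}
    (hK : ContinuousOn K (Set.Icc a b ×ˢ Set.Icc c d))
    (hw : Integrable w ((volume.restrict (Set.Ioc a b)).prod (volume.restrict (Set.Ioc c d)))) :
    Integrable (fun z => K z * w z)
      ((volume.restrict (Set.Ioc a b)).prod (volume.restrict (Set.Ioc c d))) := by
  rw [Measure.prod_restrict] at hw ⊢
  have hsub : Set.Ioc a b ×ˢ Set.Ioc c d ⊆ Set.Icc a b ×ˢ Set.Icc c d :=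
    Set.prod_mono Set.Ioc_subset_Icc_self Set.Ioc_subset_Icc_self
  have hmeas : MeasurableSet (Set.Ioc a b ×ˢ Set.Ioc c d) :=
    measurableSet_Ioc.prod measurableSet_Ioc
  obtain ⟨C, hC⟩ := (isCompact_Icc.prod isCompact_Icc).exists_bound_of_continuousOn hK
  exact hw.bdd_mul ((hK.mono hsub).aestronglyMeasurable hmeas)
    ((ae_restrict_mem hmeas).mono fun z hz => hC z (hsub hz))

/-- Integration by parts on an interval when the second factor vanishes at both endpoints. -/
theorem setIntegral_mul_deriv_add_deriv_mul_eq_zero {a b : ℝ} (hab : a ≤ b) {u v u' v' : ℝ → ℝ}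
    (hu : ∀ x ∈ Set.Icc a b, HasDerivAt u (u' x) x)
    (hv : ∀ x ∈ Set.Icc a b, HasDerivAt v (v' x) x)
    (hu' : ContinuousOn u' (Set.Icc a b)) (hv' : ContinuousOn v' (Set.Icc a b))
    (hva : v a = 0) (hvb : v b = 0) :
    ∫ x in Set.Ioc a b, (u x * v' x + u' x * v x) = 0 := by
  rw [← Set.uIcc_of_le hab] at hu hv hu' hv'
  have h := intervalIntegral.integral_deriv_mul_eq_sub hu hv hu'.intervalIntegrable
    hv'.intervalIntegrable
  rw [← intervalIntegral.integral_of_le hab]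
  simpa [hva, hvb, add_comm] using h

/-- The two conformable exponents cancel away from the base point. -/
theorem rpow_one_sub_mul_rpow_sub_one {x a α : ℝ} (hx : a < x) :
    (x - a) ^ (1 - α) * (x - a) ^ (α - 1) = 1 := by
  rw [← Real.rpow_add (sub_pos.2 hx)]
  simp

/-- Conformable Green-type lemma: for continuously differentiable `F, G, h` on the
rectangle `R = [a,b]×[c,d]` with `h = 0` on the boundary `∂R`,
`∫_R (G·∂^α_a h/∂x₁^α − F·∂^α_c h/∂x₂^α) d^α_a x₁ d^α_c x₂
  = −∫_R (∂^α_a G/∂x₁^α − ∂^α_c F/∂x₂^α)·h d^α_a x₁ d^α_c x₂`,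
where `∂^α_a/∂x₁^α = (x₁−a)^{1−α} ∂/∂x₁`, `∂^α_c/∂x₂^α = (x₂−c)^{1−α} ∂/∂x₂`, and the
conformable integrals carry the weights `(x₁−a)^{α−1}` and `(x₂−c)^{α−1}`. -/
theorem conformable_green_lemma
    (α a b c d : ℝ) (hα0 : 0 < α) (hα1 : α ≤ 1) (hab : a < b) (hcd : c < d)
    (F G h F₁ F₂ G₁ G₂ h₁ h₂ : ℝ → ℝ → ℝ)
    (hF₁ : ∀ x₁ ∈ Set.Icc a b, ∀ x₂ ∈ Set.Icc c d,
      HasDerivAt (fun t => F t x₂) (F₁ x₁ x₂) x₁)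
    (hF₂ : ∀ x₁ ∈ Set.Icc a b, ∀ x₂ ∈ Set.Icc c d,
      HasDerivAt (fun t => F x₁ t) (F₂ x₁ x₂) x₂)
    (hG₁ : ∀ x₁ ∈ Set.Icc a b, ∀ x₂ ∈ Set.Icc c d,
      HasDerivAt (fun t => G t x₂) (G₁ x₁ x₂) x₁)
    (hG₂ : ∀ x₁ ∈ Set.Icc a b, ∀ x₂ ∈ Set.Icc c d,
      HasDerivAt (fun t => G x₁ t) (G₂ x₁ x₂) x₂)
    (hh₁ : ∀ x₁ ∈ Set.Icc a b, ∀ x₂ ∈ Set.Icc c d,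
      HasDerivAt (fun t => h t x₂) (h₁ x₁ x₂) x₁)
    (hh₂ : ∀ x₁ ∈ Set.Icc a b, ∀ x₂ ∈ Set.Icc c d,
      HasDerivAt (fun t => h x₁ t) (h₂ x₁ x₂) x₂)
    (hFc : ContinuousOn (fun q : ℝ × ℝ => F q.1 q.2) (Set.Icc a b ×ˢ Set.Icc c d))
    (hGc : ContinuousOn (fun q : ℝ × ℝ => G q.1 q.2) (Set.Icc a b ×ˢ Set.Icc c d))
    (hhc : ContinuousOn (fun q : ℝ × ℝ => h q.1 q.2) (Set.Icc a b ×ˢ Set.Icc c d))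
    (hF₁c : ContinuousOn (fun q : ℝ × ℝ => F₁ q.1 q.2) (Set.Icc a b ×ˢ Set.Icc c d))
    (hF₂c : ContinuousOn (fun q : ℝ × ℝ => F₂ q.1 q.2) (Set.Icc a b ×ˢ Set.Icc c d))
    (hG₁c : ContinuousOn (fun q : ℝ × ℝ => G₁ q.1 q.2) (Set.Icc a b ×ˢ Set.Icc c d))
    (hG₂c : ContinuousOn (fun q : ℝ × ℝ => G₂ q.1 q.2) (Set.Icc a b ×ˢ Set.Icc c d))
    (hh₁c : ContinuousOn (fun q : ℝ × ℝ => h₁ q.1 q.2) (Set.Icc a b ×ˢ Set.Icc c d))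
    (hh₂c : ContinuousOn (fun q : ℝ × ℝ => h₂ q.1 q.2) (Set.Icc a b ×ˢ Set.Icc c d))
    (hbd₁ : ∀ x₂ ∈ Set.Icc c d, h a x₂ = 0 ∧ h b x₂ = 0)
    (hbd₂ : ∀ x₁ ∈ Set.Icc a b, h x₁ c = 0 ∧ h x₁ d = 0) :
    ∫ x₁ in a..b, ∫ x₂ in c..d,
      (G x₁ x₂ * ((x₁ - a) ^ (1 - α) * h₁ x₁ x₂)
        - F x₁ x₂ * ((x₂ - c) ^ (1 - α) * h₂ x₁ x₂))
        * (x₂ - c) ^ (α - 1) * (x₁ - a) ^ (α - 1) =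
    -∫ x₁ in a..b, ∫ x₂ in c..d,
      ((x₁ - a) ^ (1 - α) * G₁ x₁ x₂ - (x₂ - c) ^ (1 - α) * F₂ x₁ x₂) * h x₁ x₂
        * (x₂ - c) ^ (α - 1) * (x₁ - a) ^ (α - 1) := by
  set μ : Measure ℝ := volume.restrict (Set.Ioc a b)
  set ν : Measure ℝ := volume.restrict (Set.Ioc c d)
  have hw₁ : Integrable (fun z : ℝ × ℝ => (z.1 - a) ^ (α - 1)) (μ.prod ν) :=
    (integrable_conformable_weight hα0 hab.le).comp_fst ν
  have hw₂ : Integrable (fun z : ℝ × ℝ => (z.2 - c) ^ (α - 1)) (μ.prod ν) :=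
    (integrable_conformable_weight hα0 hcd.le).comp_snd μ
  have hGh₁ : Integrable (fun z : ℝ × ℝ =>
      G z.1 z.2 * h₁ z.1 z.2 * (z.2 - c) ^ (α - 1)) (μ.prod ν) :=
    (hGc.mul hh₁c).integrable_mul_of_rectangle hw₂
  have hG₁h : Integrable (fun z : ℝ × ℝ =>
      G₁ z.1 z.2 * h z.1 z.2 * (z.2 - c) ^ (α - 1)) (μ.prod ν) :=
    (hG₁c.mul hhc).integrable_mul_of_rectangle hw₂
  have hFh₂ : Integrable (fun z : ℝ × ℝ =>
      F z.1 z.2 * h₂ z.1 z.2 * (z.1 - a) ^ (α - 1)) (μ.prod ν) :=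
    (hFc.mul hh₂c).integrable_mul_of_rectangle hw₁
  have hF₂h : Integrable (fun z : ℝ × ℝ =>
      F₂ z.1 z.2 * h z.1 z.2 * (z.1 - a) ^ (α - 1)) (μ.prod ν) :=
    (hF₂c.mul hhc).integrable_mul_of_rectangle hw₁
  have hG0 : ∫ z, (G z.1 z.2 * h₁ z.1 z.2 + G₁ z.1 z.2 * h z.1 z.2) * (z.2 - c) ^ (α - 1)
      ∂μ.prod ν = 0 := by
    have hsum : Integrable (fun z : ℝ × ℝ =>
        (G z.1 z.2 * h₁ z.1 z.2 + G₁ z.1 z.2 * h z.1 z.2) * (z.2 - c) ^ (α - 1)) (μ.prod ν) :=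
      ((hGc.mul hh₁c).add (hG₁c.mul hhc)).integrable_mul_of_rectangle hw₂
    rw [integral_prod_symm _ hsum]
    refine setIntegral_eq_zero_of_forall_eq_zero fun y hy => ?_
    have hy' := Set.Ioc_subset_Icc_self hy
    have hline : ContinuousOn (fun x : ℝ => (x, y)) (Set.Icc a b) := by fun_prop
    have hmaps : Set.MapsTo (fun x : ℝ => (x, y)) (Set.Icc a b) (Set.Icc a b ×ˢ Set.Icc c d) :=
      fun x hx => ⟨hx, hy'⟩
    dsimp only
    rw [integral_mul_const, setIntegral_mul_deriv_add_deriv_mul_eq_zero hab.le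
      (fun x hx => hG₁ x hx y hy') (fun x hx => hh₁ x hx y hy') (hG₁c.comp hline hmaps)
      (hh₁c.comp hline hmaps) (hbd₁ y hy').1 (hbd₁ y hy').2, zero_mul]
  have hF0 : ∫ z, (F z.1 z.2 * h₂ z.1 z.2 + F₂ z.1 z.2 * h z.1 z.2) * (z.1 - a) ^ (α - 1)
      ∂μ.prod ν = 0 := by
    have hsum : Integrable (fun z : ℝ × ℝ =>
        (F z.1 z.2 * h₂ z.1 z.2 + F₂ z.1 z.2 * h z.1 z.2) * (z.1 - a) ^ (α - 1)) (μ.prod ν) :=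
      ((hFc.mul hh₂c).add (hF₂c.mul hhc)).integrable_mul_of_rectangle hw₁
    rw [integral_prod _ hsum]
    refine setIntegral_eq_zero_of_forall_eq_zero fun x hx => ?_
    have hx' := Set.Ioc_subset_Icc_self hx
    have hline : ContinuousOn (fun y : ℝ => (x, y)) (Set.Icc c d) := by fun_prop
    have hmaps : Set.MapsTo (fun y : ℝ => (x, y)) (Set.Icc c d) (Set.Icc a b ×ˢ Set.Icc c d) :=
      fun y hy => ⟨hx', hy⟩
    dsimp only
    rw [integral_mul_const, setIntegral_mul_deriv_add_deriv_mul_eq_zero hcd.le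
      (fun y hy => hF₂ x hx' y hy) (fun y hy => hh₂ x hx' y hy) (hF₂c.comp hline hmaps)
      (hh₂c.comp hline hmaps) (hbd₂ x hx').1 (hbd₂ x hx').2, zero_mul]
  have hL : ∫ x₁ in a..b, ∫ x₂ in c..d,
      (G x₁ x₂ * ((x₁ - a) ^ (1 - α) * h₁ x₁ x₂)
        - F x₁ x₂ * ((x₂ - c) ^ (1 - α) * h₂ x₁ x₂))
        * (x₂ - c) ^ (α - 1) * (x₁ - a) ^ (α - 1) =
      ∫ z, (G z.1 z.2 * h₁ z.1 z.2 * (z.2 - c) ^ (α - 1)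
        - F z.1 z.2 * h₂ z.1 z.2 * (z.1 - a) ^ (α - 1)) ∂μ.prod ν := by
    refine Eq.trans ?_ (integral_prod _ (hGh₁.sub hFh₂)).symm
    simp only [intervalIntegral.integral_of_le hab.le, intervalIntegral.integral_of_le hcd.le]
    refine setIntegral_congr_fun measurableSet_Ioc fun x hx => ?_
    refine setIntegral_congr_fun measurableSet_Ioc fun y hy => ?_
    simp only [Pi.sub_apply]
    linear_combination
      G x y * h₁ x y * (y - c) ^ (α - 1) * rpow_one_sub_mul_rpow_sub_one (α := α) hx.1
        - F x y * h₂ x y * (x - a) ^ (α - 1) * rpow_one_sub_mul_rpow_sub_one (α := α) hy.1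
  have hR : ∫ x₁ in a..b, ∫ x₂ in c..d,
      ((x₁ - a) ^ (1 - α) * G₁ x₁ x₂ - (x₂ - c) ^ (1 - α) * F₂ x₁ x₂) * h x₁ x₂
        * (x₂ - c) ^ (α - 1) * (x₁ - a) ^ (α - 1) =
      ∫ z, (G₁ z.1 z.2 * h z.1 z.2 * (z.2 - c) ^ (α - 1)
        - F₂ z.1 z.2 * h z.1 z.2 * (z.1 - a) ^ (α - 1)) ∂μ.prod ν := by
    refine Eq.trans ?_ (integral_prod _ (hG₁h.sub hF₂h)).symm
    simp only [intervalIntegral.integral_of_le hab.le, intervalIntegral.integral_of_le hcd.le]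
    refine setIntegral_congr_fun measurableSet_Ioc fun x hx => ?_
    refine setIntegral_congr_fun measurableSet_Ioc fun y hy => ?_
    simp only [Pi.sub_apply]
    linear_combination
      G₁ x y * h x y * (y - c) ^ (α - 1) * rpow_one_sub_mul_rpow_sub_one (α := α) hx.1
        - F₂ x y * h x y * (x - a) ^ (α - 1) * rpow_one_sub_mul_rpow_sub_one (α := α) hy.1
  simp only [add_mul] at hG0 hF0
  rw [integral_add hGh₁ hG₁h] at hG0
  rw [integral_add hFh₂ hF₂h] at hF0
  rw [hL, hR, integral_sub hGh₁ hFh₂, integral_sub hG₁h hF₂h]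
  linarith
end

section
/- Multi-dimensional conformable fractional Euler–Lagrange equation: let 0 < α ≤ 1, a < b, R = [a,b]×[a,b], m ∈ ℕ, and let L = L(x₁,x₂,y₁,…,y_m,v_{1,1},v_{1,2},…,v_{m,1},v_{m,2}) : R×ℝ^m×ℝ^{2m} → ℝ be of class C¹. Let y = (y₁,…,y_m) : R → ℝ^m be continuously differentiable with y = ψ on the boundary ∂R for a given function ψ, and write (∂^α_a y_k/∂x_i^α)(x) = (x_i−a)^{1−α}(∂y_k/∂x_i)(x). Assume the maps x ↦ (∂L/∂v_{k,i})(x, y(x), ∂^α_a y/∂x^α(x)) are continuously differentiable. Suppose that for every continuously differentiable η = (η₁,…,η_m) : R → ℝ^m vanishing on ∂R, the function ε ↦ ∫_a^b ∫_a^b L(x₁,x₂, y(x)+εη(x), ∂^α_a y/∂x^α(x)+ε ∂^α_a η/∂x^α(x)) (x₂−a)^{α−1}(x₁−a)^{α−1} dx₂ dx₁ has derivative 0 at ε = 0. Then for every k ∈ {1,…,m} and every x in the interior of R: (∂L/∂y_k) − (x₁−a)^{1−α}(∂/∂x₁)(∂L/∂v_{k,1}) − (x₂−a)^{1−α}(∂/∂x₂)(∂L/∂v_{k,2})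 = 0, with all partial derivatives of L evaluated at (x₁,x₂, y(x), ∂^α_a y/∂x^α(x)). -/
open MeasureTheory

/-- A function on a square with continuous partial derivatives is jointly continuous. -/
theorem continuousOn_prod_Icc_of_hasDerivAt {a b : ℝ} {f f₁ f₂ : ℝ → ℝ → ℝ}
    (h₁ : ∀ x ∈ Set.Icc a b, ∀ t ∈ Set.Icc a b, HasDerivAt (fun s => f s t) (f₁ x t) x)
    (h₂ : ∀ x ∈ Set.Icc a b, ∀ t ∈ Set.Icc a b, HasDerivAt (fun s => f x s) (f₂ x t) t)
    (hc : ContinuousOn (fun q : ℝ × ℝ => f₁ q.1 q.2) (Set.Icc a b ×ˢ Set.Icc a b)) :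
    ContinuousOn (fun q : ℝ × ℝ => f q.1 q.2) (Set.Icc a b ×ˢ Set.Icc a b) := by
  obtain ⟨C, hC⟩ := (isCompact_Icc.prod isCompact_Icc).exists_bound_of_continuousOn hc
  refine continuousOn_prod_of_continuousOn_lipschitzOnWith _ C.toNNReal
    (fun x hx t ht => (h₂ x hx t ht).continuousAt.continuousWithinAt) fun t ht => ?_
  refine (convex_Icc a b).lipschitzOnWith_of_nnnorm_hasDerivWithin_le
    (fun x hx => (h₁ x hx t ht).hasDerivWithinAt) fun x hx => ?_
  rw [← NNReal.coe_le_coe, coe_nnnorm]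
  exact (hC (x, t) ⟨hx, ht⟩).trans (Real.le_coe_toNNReal C)

theorem integrable_mul_of_continuousOn_isCompact {E : Type*} [TopologicalSpace E]
    [MeasurableSpace E] [OpensMeasurableSpace E] [SecondCountableTopology E] {μ : Measure E}
    {K : Set E} (hK : IsCompact K) (hKm : MeasurableSet K) (hμ : ∀ᵐ q ∂μ, q ∈ K) {W h : E → ℝ}
    (hW : Integrable W μ) (hh : ContinuousOn h K) : Integrable (fun q => h q * W q) μ := by
  obtain ⟨C, hC⟩ := hK.exists_bound_of_continuousOn hh
  have hm : AEStronglyMeasurable h μ := by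
    rw [← Measure.restrict_eq_self_of_ae_mem hμ]
    exact hh.aestronglyMeasurable hKm
  exact hW.bdd_mul hm (hμ.mono hC)

/-- Differentiation under the integral sign of a weighted `C¹` Lagrangian along a line. -/
theorem hasDerivAt_integral_lagrangian {E X : Type*} [TopologicalSpace E]
    [MeasurableSpace E] [OpensMeasurableSpace E] [SecondCountableTopology E] [NormedAddCommGroup X]
    [NormedSpace ℝ X] {μ : Measure E}
    {K : Set E} (hK : IsCompact K) (hKm : MeasurableSet K) (hμ : ∀ᵐ q ∂μ, q ∈ K) {W : E → ℝ}
    (hW : Integrable W μ) {Λ : X → ℝ} (hΛ : ContDiff ℝ 1 Λ) {z h : E → X}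
    (hz : ContinuousOn z K) (hh : ContinuousOn h K) :
    HasDerivAt (fun ε : ℝ => ∫ q, Λ (z q + ε • h q) * W q ∂μ)
      (∫ q, fderiv ℝ Λ (z q) (h q) * W q ∂μ) 0 := by
  have hcurve : ContinuousOn (fun p : ℝ × E => z p.2 + p.1 • h p.2) (Set.Icc (-1) 1 ×ˢ K) :=
    (hz.comp continuousOn_snd fun p hp => hp.2).add
      (continuousOn_fst.smul (hh.comp continuousOn_snd fun p hp => hp.2))
  have hderiv : ContinuousOn (fun p : ℝ × E => fderiv ℝ Λ (z p.2 + p.1 • h p.2) (h p.2))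
      (Set.Icc (-1) 1 ×ˢ K) :=
    ((hΛ.continuous_fderiv one_ne_zero).comp_continuousOn hcurve).clm_apply
      (hh.comp continuousOn_snd fun p hp => hp.2)
  obtain ⟨C, hC⟩ := (isCompact_Icc.prod hK).exists_bound_of_continuousOn hderiv
  have hint (ε : ℝ) : Integrable (fun q => Λ (z q + ε • h q) * W q) μ :=
    integrable_mul_of_continuousOn_isCompact hK hKm hμ hW
      (hΛ.continuous.comp_continuousOn (hz.add (hh.const_smul ε)))
  have key := hasDerivAt_integral_of_dominated_loc_of_deriv_le (μ := μ) (x₀ := (0 : ℝ))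
    (F := fun ε q => Λ (z q + ε • h q) * W q)
    (F' := fun ε q => fderiv ℝ Λ (z q + ε • h q) (h q) * W q)
    (bound := fun q => C * ‖W q‖) (s := Set.Icc (-1) 1)
    (Icc_mem_nhds (by norm_num) (by norm_num))
    (.of_forall fun ε => (hint ε).aestronglyMeasurable) (hint 0)
    (integrable_mul_of_continuousOn_isCompact hK hKm hμ hW
      (((hΛ.continuous_fderiv one_ne_zero).comp_continuousOn
        (hz.add (hh.const_smul (0 : ℝ)))).clm_apply hh)).aestronglyMeasurable
    (hμ.mono fun q hq ε hε => by
      rw [norm_mul]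
      exact mul_le_mul_of_nonneg_right (hC (ε, q) ⟨hε, hq⟩) (norm_nonneg _))
    (hW.norm.const_mul C)
    (.of_forall fun q ε _ => by
      have hline : HasDerivAt (fun ε : ℝ => z q + ε • h q) (h q) ε := by
        simpa using ((hasDerivAt_id ε).smul_const (h q)).const_add (z q)
      exact (((hΛ.differentiable one_ne_zero).differentiableAt.hasFDerivAt).comp_hasDerivAt ε
        hline).mul_const (W q))
  simpa using key.2

theorem integral_Ioo_deriv_mul_add_mul_deriv_eq_zero {a b : ℝ} (hab : a < b) {Q D f f' : ℝ → ℝ}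
    (hQ : ContinuousOn Q (Set.Icc a b)) (hD : ContinuousOn D (Set.Icc a b))
    (hQD : ∀ x ∈ Set.Ioo a b, HasDerivAt Q (D x) x) (hf : ∀ x, HasDerivAt f (f' x) x)
    (hf' : Continuous f') (ha : f a = 0) (hb : f b = 0) :
    ∫ x in Set.Ioo a b, (D x * f x + Q x * f' x) = 0 := by
  have hfc : Continuous f := continuous_iff_continuousAt.2 fun x => (hf x).continuousAt
  have hint : IntervalIntegrable (fun x => D x * f x + Q x * f' x) volume a b := by
    apply ContinuousOn.intervalIntegrable
    rw [Set.uIcc_of_le hab.le]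
    exact (hD.mul hfc.continuousOn).add (hQ.mul hf'.continuousOn)
  rw [← integral_Ioc_eq_integral_Ioo, ← intervalIntegral.integral_of_le hab.le,
    intervalIntegral.integral_eq_sub_of_hasDerivAt_of_le (f := fun x => Q x * f x) hab.le
      (hQ.mul hfc.continuousOn) (fun x hx => (hQD x hx).mul (hf x)) hint, ha, hb]
  simp

theorem integrableOn_Ioo_sub_rpow {a b r : ℝ} (hab : a < b) (hr : -1 < r) :
    IntegrableOn (fun x : ℝ => (x - a) ^ r) (Set.Ioo a b) := by
  have h := (intervalIntegral.intervalIntegrable_rpow' (a := 0) (b := b - a) hr).comp_sub_right a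
  rw [zero_add, sub_add_cancel, intervalIntegrable_iff_integrableOn_Ioo_of_le hab.le] at h
  exact h

theorem integrableOn_conformable_weight {α a b : ℝ} (hα0 : 0 < α) (hab : a < b) :
    IntegrableOn (fun q : ℝ × ℝ => (q.2 - a) ^ (α - 1) * (q.1 - a) ^ (α - 1))
      (Set.Ioo a b ×ˢ Set.Ioo a b) := by
  have hw := integrableOn_Ioo_sub_rpow (r := α - 1) hab (by linarith)
  rw [IntegrableOn, Measure.volume_eq_prod, ← Measure.prod_restrict]
  exact (Integrable.mul_prod hw hw).congr (.of_forall fun q => mul_comm _ _)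

theorem intervalIntegral_intervalIntegral_eq_setIntegral {a b : ℝ} (hab : a ≤ b) {f : ℝ × ℝ → ℝ}
    (hf : IntegrableOn f (Set.Ioo a b ×ˢ Set.Ioo a b)) :
    ∫ x in a..b, ∫ t in a..b, f (x, t) = ∫ q in Set.Ioo a b ×ˢ Set.Ioo a b, f q := by
  rw [IntegrableOn, Measure.volume_eq_prod, ← Measure.prod_restrict] at hf
  rw [Measure.volume_eq_prod, ← Measure.prod_restrict, integral_prod _ hf]
  simp only [intervalIntegral.integral_of_le hab, integral_Ioc_eq_integral_Ioo]

/-- The weak conformable Euler–Lagrange equation on a square implies the pointwise one. -/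
theorem conformable_eulerLagrange_of_weak {α a b : ℝ} (hα0 : 0 < α) (hab : a < b)
    {P Q₁ Q₂ D₁ D₂ : ℝ × ℝ → ℝ}
    (hP : ContinuousOn P (Set.Icc a b ×ˢ Set.Icc a b))
    (hQ₁ : ContinuousOn Q₁ (Set.Icc a b ×ˢ Set.Icc a b))
    (hQ₂ : ContinuousOn Q₂ (Set.Icc a b ×ˢ Set.Icc a b))
    (hD₁ : ContinuousOn D₁ (Set.Icc a b ×ˢ Set.Icc a b))
    (hD₂ : ContinuousOn D₂ (Set.Icc a b ×ˢ Set.Icc a b))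
    (hQD₁ : ∀ x ∈ Set.Ioo a b, ∀ t ∈ Set.Ioo a b, HasDerivAt (fun s => Q₁ (s, t)) (D₁ (x, t)) x)
    (hQD₂ : ∀ x ∈ Set.Ioo a b, ∀ t ∈ Set.Ioo a b, HasDerivAt (fun s => Q₂ (x, s)) (D₂ (x, t)) t)
    (hweak : ∀ g : ℝ × ℝ → ℝ, ContDiff ℝ 1 g → tsupport g ⊆ Set.Ioo a b ×ˢ Set.Ioo a b →
      ∫ q in Set.Ioo a b ×ˢ Set.Ioo a b,
        (g q * P q + (q.1 - a) ^ (1 - α) * fderiv ℝ g q (1, 0) * Q₁ q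
          + (q.2 - a) ^ (1 - α) * fderiv ℝ g q (0, 1) * Q₂ q)
          * ((q.2 - a) ^ (α - 1) * (q.1 - a) ^ (α - 1)) = 0)
    {x₁ x₂ : ℝ} (hx₁ : x₁ ∈ Set.Ioo a b) (hx₂ : x₂ ∈ Set.Ioo a b) :
    P (x₁, x₂) - (x₁ - a) ^ (1 - α) * D₁ (x₁, x₂) - (x₂ - a) ^ (1 - α) * D₂ (x₁, x₂) = 0 := by
  set U : Set (ℝ × ℝ) := Set.Ioo a b ×ˢ Set.Ioo a b with hU
  set K : Set (ℝ × ℝ) := Set.Icc a b ×ˢ Set.Icc a b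
  have hUo : IsOpen U := isOpen_Ioo.prod isOpen_Ioo
  have hUK : U ⊆ K := Set.prod_mono Set.Ioo_subset_Icc_self Set.Ioo_subset_Icc_self
  have hK : IsCompact K := isCompact_Icc.prod isCompact_Icc
  have hprod : (volume : Measure (ℝ × ℝ)).restrict U
      = (volume.restrict (Set.Ioo a b)).prod (volume.restrict (Set.Ioo a b)) :=
    (Measure.prod_restrict _ _).symm
  have hμ : ∀ᵐ q ∂(volume : Measure (ℝ × ℝ)).restrict U, q ∈ K :=
    (ae_restrict_mem hUo.measurableSet).mono fun q hq => hUK hq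
  have hmul {W h : ℝ × ℝ → ℝ} (hW : IntegrableOn W U volume) (hh : ContinuousOn h K) :
      IntegrableOn (fun q => h q * W q) U volume :=
    integrable_mul_of_continuousOn_isCompact hK hK.measurableSet hμ hW hh
  have hw := integrableOn_Ioo_sub_rpow (r := α - 1) hab (by linarith)
  have hone : IntegrableOn (fun _ : ℝ => (1 : ℝ)) (Set.Ioo a b) := integrableOn_const (by simp)
  have hW : IntegrableOn (fun q : ℝ × ℝ => (q.2 - a) ^ (α - 1) * (q.1 - a) ^ (α - 1)) U :=
    integrableOn_conformable_weight hα0 hab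
  have hW₁ : IntegrableOn (fun q : ℝ × ℝ => (q.1 - a) ^ (α - 1)) U := by
    rw [IntegrableOn, hprod]
    simpa using Integrable.mul_prod hw hone
  have hW₂ : IntegrableOn (fun q : ℝ × ℝ => (q.2 - a) ^ (α - 1)) U := by
    rw [IntegrableOn, hprod]
    simpa using Integrable.mul_prod hone hw
  set G : ℝ × ℝ → ℝ := fun q => P q * ((q.2 - a) ^ (α - 1) * (q.1 - a) ^ (α - 1))
    - D₁ q * (q.2 - a) ^ (α - 1) - D₂ q * (q.1 - a) ^ (α - 1) with hG
  have hGint : IntegrableOn G U := ((hmul hW hP).sub (hmul hW₂ hD₁)).sub (hmul hW₁ hD₂)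
  have hcancel {x : ℝ} (hx : x ∈ Set.Ioo a b) : (x - a) ^ (1 - α) * (x - a) ^ (α - 1) = 1 := by
    rw [← Real.rpow_add (sub_pos.2 hx.1)]
    simp
  have hGtest (g : ℝ × ℝ → ℝ) (hg : ContDiff ℝ 1 g) (hsupp : tsupport g ⊆ U) :
      ∫ q in U, g q * G q = 0 := by
    have hg0 {q : ℝ × ℝ} (hq : q ∉ U) : g q = 0 := image_eq_zero_of_notMem_tsupport
      fun h => hq (hsupp h)
    have hd := hg.continuous_fderiv one_ne_zero
    have hgd (q : ℝ × ℝ) : HasFDerivAt g (fderiv ℝ g q) q :=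
      (hg.differentiable one_ne_zero).differentiableAt.hasFDerivAt
    have hg₁ : Continuous fun q => fderiv ℝ g q (1, 0) := hd.clm_apply continuous_const
    have hg₂ : Continuous fun q => fderiv ℝ g q (0, 1) := hd.clm_apply continuous_const
    have hgc := hg.continuous.continuousOn (s := K)
    have hI₁ : IntegrableOn (fun q => (D₁ q * g q + Q₁ q * fderiv ℝ g q (1, 0))
        * (q.2 - a) ^ (α - 1)) U :=
      hmul hW₂ ((hD₁.mul hgc).add (hQ₁.mul hg₁.continuousOn))
    have hI₂ : IntegrableOn (fun q => (D₂ q * g q + Q₂ q * fderiv ℝ g q (0, 1))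
        * (q.1 - a) ^ (α - 1)) U :=
      hmul hW₁ ((hD₂.mul hgc).add (hQ₂.mul hg₂.continuousOn))
    have hz₁ : ∫ q in U, (D₁ q * g q + Q₁ q * fderiv ℝ g q (1, 0)) * (q.2 - a) ^ (α - 1) = 0 := by
      rw [IntegrableOn, hprod] at hI₁
      rw [hprod, integral_prod_symm _ hI₁]
      refine setIntegral_eq_zero_of_forall_eq_zero fun t ht => ?_
      have htK := Set.Ioo_subset_Icc_self ht
      have hmaps : Set.MapsTo (fun s : ℝ => (s, t)) (Set.Icc a b) K := fun s hs => ⟨hs, htK⟩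
      have hline : Continuous fun s : ℝ => (s, t) := by fun_prop
      dsimp only
      rw [integral_mul_const]
      exact mul_eq_zero_of_left (integral_Ioo_deriv_mul_add_mul_deriv_eq_zero
        (f := fun s => g (s, t)) hab
        (hQ₁.comp hline.continuousOn hmaps) (hD₁.comp hline.continuousOn hmaps)
        (fun x hx => hQD₁ x hx t ht)
        (fun x => (hgd (x, t)).comp_hasDerivAt x ((hasDerivAt_id x).prodMk (hasDerivAt_const x t)))
        (hg₁.comp hline) (hg0 (by simp [hU])) (hg0 (by simp [hU]))) _
    have hz₂ : ∫ q in U, (D₂ q * g q + Q₂ q * fderiv ℝ g q (0, 1)) * (q.1 - a) ^ (α - 1) = 0 := by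
      rw [IntegrableOn, hprod] at hI₂
      rw [hprod, integral_prod _ hI₂]
      refine setIntegral_eq_zero_of_forall_eq_zero fun t ht => ?_
      have htK := Set.Ioo_subset_Icc_self ht
      have hmaps : Set.MapsTo (fun s : ℝ => (t, s)) (Set.Icc a b) K := fun s hs => ⟨htK, hs⟩
      have hline : Continuous fun s : ℝ => (t, s) := by fun_prop
      dsimp only
      rw [integral_mul_const]
      exact mul_eq_zero_of_left (integral_Ioo_deriv_mul_add_mul_deriv_eq_zero
        (f := fun s => g (t, s)) hab
        (hQ₂.comp hline.continuousOn hmaps) (hD₂.comp hline.continuousOn hmaps)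
        (fun x hx => hQD₂ t ht x hx)
        (fun x => (hgd (t, x)).comp_hasDerivAt x ((hasDerivAt_const x t).prodMk (hasDerivAt_id x)))
        (hg₂.comp hline) (hg0 (by simp [hU])) (hg0 (by simp [hU]))) _
    have hgG : IntegrableOn (fun q => g q * G q) U := hmul hGint hgc
    have hgGI : IntegrableOn (fun q => g q * G q
        + (D₁ q * g q + Q₁ q * fderiv ℝ g q (1, 0)) * (q.2 - a) ^ (α - 1)) U := hgG.add hI₁
    have hsum := hweak g hg hsupp
    rw [← setIntegral_congr_fun (f := fun q => g q * G q
      + (D₁ q * g q + Q₁ q * fderiv ℝ g q (1, 0)) * (q.2 - a) ^ (α - 1)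
      + (D₂ q * g q + Q₂ q * fderiv ℝ g q (0, 1)) * (q.1 - a) ^ (α - 1)) hUo.measurableSet
      fun q hq => ?_] at hsum
    · rw [integral_add hgGI hI₂, integral_add hgG hI₁, hz₁, hz₂] at hsum
      simpa using hsum
    · simp only [hG]
      linear_combination
        (-(fderiv ℝ g q (1, 0)) * Q₁ q * (q.2 - a) ^ (α - 1)) * hcancel hq.1
        - (fderiv ℝ g q (0, 1) * Q₂ q * (q.1 - a) ^ (α - 1)) * hcancel hq.2
  have hGae : ∀ᵐ q ∂(volume : Measure (ℝ × ℝ)), q ∈ U → G q = 0 := by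
    refine hUo.ae_eq_zero_of_integral_contDiff_smul_eq_zero hGint.locallyIntegrableOn
      fun g hg _ hsupp => ?_
    rw [← setIntegral_eq_integral_of_forall_compl_eq_zero (s := U) fun q hq => by
      rw [image_eq_zero_of_notMem_tsupport fun h => hq (hsupp h), zero_smul]]
    exact hGtest g (hg.of_le (by exact_mod_cast le_top)) hsupp
  have hrpow (f : ℝ × ℝ → ℝ) (hf : Continuous f) (hpos : ∀ q ∈ U, 0 < f q) :
      ContinuousOn (fun q => f q ^ (α - 1)) U :=
    hf.continuousOn.rpow_const fun q hq => .inl (hpos q hq).ne'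
  have hr₁ := hrpow (fun q => q.1 - a) (by fun_prop) fun q hq => sub_pos.2 hq.1.1
  have hr₂ := hrpow (fun q => q.2 - a) (by fun_prop) fun q hq => sub_pos.2 hq.2.1
  have hGc : ContinuousOn G U :=
    (((hP.mono hUK).mul (hr₂.mul hr₁)).sub ((hD₁.mono hUK).mul hr₂)).sub ((hD₂.mono hUK).mul hr₁)
  have hzero : G (x₁, x₂) = 0 :=
    Measure.eqOn_open_of_ae_eq (μ := volume) (g := fun _ => (0 : ℝ))
      ((ae_restrict_iff' hUo.measurableSet).2 hGae) hUo hGc continuousOn_const ⟨hx₁, hx₂⟩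
  simp only [hG] at hzero
  linear_combination ((x₁ - a) ^ (1 - α) * (x₂ - a) ^ (1 - α)) * hzero
    - (P (x₁, x₂) * (x₂ - a) ^ (1 - α) * (x₂ - a) ^ (α - 1)
      - D₂ (x₁, x₂) * (x₂ - a) ^ (1 - α)) * hcancel hx₁
    - (P (x₁, x₂) - D₁ (x₁, x₂) * (x₁ - a) ^ (1 - α)) * hcancel hx₂

/-- The multi-dimensional conformable fractional Euler–Lagrange equation over the square
`R = [a,b]×[a,b]`, for `m` dependent variables. The Lagrangian is
`L(x₁,x₂,y,v)` with `y ∈ ℝ^m` and `v = (v_{k,1}, v_{k,2})_{k} ∈ (ℝ×ℝ)^m`; the functional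
is `J(y) = ∬_R L(x, y(x), ∂^α_a y/∂x^α(x)) (x₂−a)^{α−1}(x₁−a)^{α−1} dx₂ dx₁` with
`∂^α_a y_k/∂x_i^α = (x_i−a)^{1−α} ∂y_k/∂x_i`. If the first variation vanishes at every
admissible variation `η` vanishing on `∂R`, then for every `k` and every interior point,
`∂L/∂y_k − ∂^α_a/∂x₁^α (∂L/∂v_{k,1}) − ∂^α_a/∂x₂^α (∂L/∂v_{k,2}) = 0`.
Partial derivatives of `L` are expressed via `fderiv` applied to coordinate directions;
`D1 k` (resp. `D2 k`) is the ordinary partial derivative with respect to `x₁` (resp.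
`x₂`) of `x ↦ (∂L/∂v_{k,1})(x,y(x),∂^α y(x))` (resp. of `∂L/∂v_{k,2}`). -/
theorem multidim_conformable_euler_lagrange
    (α a b : ℝ) (hα0 : 0 < α) (hα1 : α ≤ 1) (hab : a < b) (m : ℕ)
    (L : ℝ → ℝ → (Fin m → ℝ) → (Fin m → ℝ × ℝ) → ℝ)
    (hL : ContDiff ℝ 1 (fun q : ℝ × ℝ × (Fin m → ℝ) × (Fin m → ℝ × ℝ) =>
      L q.1 q.2.1 q.2.2.1 q.2.2.2))
    (y y₁ y₂ : Fin m → ℝ → ℝ → ℝ)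
    (hy1 : ∀ k, ∀ x₁ ∈ Set.Icc a b, ∀ x₂ ∈ Set.Icc a b,
      HasDerivAt (fun t => y k t x₂) (y₁ k x₁ x₂) x₁)
    (hy2 : ∀ k, ∀ x₁ ∈ Set.Icc a b, ∀ x₂ ∈ Set.Icc a b,
      HasDerivAt (fun t => y k x₁ t) (y₂ k x₁ x₂) x₂)
    (hy1c : ∀ k, ContinuousOn (fun q : ℝ × ℝ => y₁ k q.1 q.2)
      (Set.Icc a b ×ˢ Set.Icc a b))
    (hy2c : ∀ k, ContinuousOn (fun q : ℝ × ℝ => y₂ k q.1 q.2)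
      (Set.Icc a b ×ˢ Set.Icc a b))
    (ψ : Fin m → ℝ → ℝ → ℝ)
    (hbd : ∀ k, ∀ x₁ ∈ Set.Icc a b, ∀ x₂ ∈ Set.Icc a b,
      (x₁ = a ∨ x₁ = b ∨ x₂ = a ∨ x₂ = b) → y k x₁ x₂ = ψ k x₁ x₂)
    (D1 D2 : Fin m → ℝ → ℝ → ℝ)
    (hD1 : ∀ k, ∀ x₁ ∈ Set.Ioo a b, ∀ x₂ ∈ Set.Ioo a b,
      HasDerivAt (fun t =>
        fderiv ℝ (fun q : ℝ × ℝ × (Fin m → ℝ) × (Fin m → ℝ × ℝ) =>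
            L q.1 q.2.1 q.2.2.1 q.2.2.2)
          (t, x₂, fun j => y j t x₂,
            fun j => ((t - a) ^ (1 - α) * y₁ j t x₂, (x₂ - a) ^ (1 - α) * y₂ j t x₂))
          (0, 0, 0, Pi.single k ((1 : ℝ), (0 : ℝ))))
        (D1 k x₁ x₂) x₁)
    (hD2 : ∀ k, ∀ x₁ ∈ Set.Ioo a b, ∀ x₂ ∈ Set.Ioo a b,
      HasDerivAt (fun t =>
        fderiv ℝ (fun q : ℝ × ℝ × (Fin m → ℝ) × (Fin m → ℝ × ℝ) =>
            L q.1 q.2.1 q.2.2.1 q.2.2.2)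
          (x₁, t, fun j => y j x₁ t,
            fun j => ((x₁ - a) ^ (1 - α) * y₁ j x₁ t, (t - a) ^ (1 - α) * y₂ j x₁ t))
          (0, 0, 0, Pi.single k ((0 : ℝ), (1 : ℝ))))
        (D2 k x₁ x₂) x₂)
    (hD1c : ∀ k, ContinuousOn (fun q : ℝ × ℝ => D1 k q.1 q.2)
      (Set.Icc a b ×ˢ Set.Icc a b))
    (hD2c : ∀ k, ContinuousOn (fun q : ℝ × ℝ => D2 k q.1 q.2)
      (Set.Icc a b ×ˢ Set.Icc a b))
    (hvar : ∀ η η₁ η₂ : Fin m → ℝ → ℝ → ℝ,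
      (∀ k, ∀ x₁ ∈ Set.Icc a b, ∀ x₂ ∈ Set.Icc a b,
        HasDerivAt (fun t => η k t x₂) (η₁ k x₁ x₂) x₁) →
      (∀ k, ∀ x₁ ∈ Set.Icc a b, ∀ x₂ ∈ Set.Icc a b,
        HasDerivAt (fun t => η k x₁ t) (η₂ k x₁ x₂) x₂) →
      (∀ k, ContinuousOn (fun q : ℝ × ℝ => η₁ k q.1 q.2)
        (Set.Icc a b ×ˢ Set.Icc a b)) →
      (∀ k, ContinuousOn (fun q : ℝ × ℝ => η₂ k q.1 q.2)
        (Set.Icc a b ×ˢ Set.Icc a b)) →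
      (∀ k, ∀ x₁ ∈ Set.Icc a b, ∀ x₂ ∈ Set.Icc a b,
        (x₁ = a ∨ x₁ = b ∨ x₂ = a ∨ x₂ = b) → η k x₁ x₂ = 0) →
      HasDerivAt (fun ε : ℝ => ∫ x₁ in a..b, ∫ x₂ in a..b,
        L x₁ x₂ (fun j => y j x₁ x₂ + ε * η j x₁ x₂)
          (fun j => ((x₁ - a) ^ (1 - α) * y₁ j x₁ x₂
                        + ε * ((x₁ - a) ^ (1 - α) * η₁ j x₁ x₂),
                     (x₂ - a) ^ (1 - α) * y₂ j x₁ x₂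
                        + ε * ((x₂ - a) ^ (1 - α) * η₂ j x₁ x₂)))
          * (x₂ - a) ^ (α - 1) * (x₁ - a) ^ (α - 1)) 0 0) :
    ∀ k, ∀ x₁ ∈ Set.Ioo a b, ∀ x₂ ∈ Set.Ioo a b,
      fderiv ℝ (fun q : ℝ × ℝ × (Fin m → ℝ) × (Fin m → ℝ × ℝ) =>
          L q.1 q.2.1 q.2.2.1 q.2.2.2)
        (x₁, x₂, fun j => y j x₁ x₂,
          fun j => ((x₁ - a) ^ (1 - α) * y₁ j x₁ x₂, (x₂ - a) ^ (1 - α) * y₂ j x₁ x₂))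
        (0, 0, Pi.single k (1 : ℝ), 0)
      - (x₁ - a) ^ (1 - α) * D1 k x₁ x₂
      - (x₂ - a) ^ (1 - α) * D2 k x₁ x₂ = 0 := by
  intro k x₁ hx₁ x₂ hx₂
  set Λ : ℝ × ℝ × (Fin m → ℝ) × (Fin m → ℝ × ℝ) → ℝ :=
    fun q => L q.1 q.2.1 q.2.2.1 q.2.2.2 with hΛ
  have hK : IsCompact (Set.Icc a b ×ˢ Set.Icc a b) := isCompact_Icc.prod isCompact_Icc
  have hμ : ∀ᵐ q ∂(volume : Measure (ℝ × ℝ)).restrict (Set.Ioo a b ×ˢ Set.Ioo a b),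
      q ∈ Set.Icc a b ×ˢ Set.Icc a b :=
    (ae_restrict_mem (measurableSet_Ioo.prod measurableSet_Ioo)).mono
      fun q hq => ⟨Set.Ioo_subset_Icc_self hq.1, Set.Ioo_subset_Icc_self hq.2⟩
  have hW := integrableOn_conformable_weight hα0 hab
  have hr : Continuous fun x : ℝ => (x - a) ^ (1 - α) :=
    (continuous_id.sub continuous_const).rpow_const fun _ => .inr (by linarith)
  have hr₁ : Continuous fun q : ℝ × ℝ => (q.1 - a) ^ (1 - α) := hr.comp continuous_fst
  have hr₂ : Continuous fun q : ℝ × ℝ => (q.2 - a) ^ (1 - α) := hr.comp continuous_snd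
  set z : ℝ × ℝ → ℝ × ℝ × (Fin m → ℝ) × (Fin m → ℝ × ℝ) := fun q =>
    (q.1, q.2, fun j => y j q.1 q.2,
      fun j => ((q.1 - a) ^ (1 - α) * y₁ j q.1 q.2, (q.2 - a) ^ (1 - α) * y₂ j q.1 q.2)) with hz
  have hzc : ContinuousOn z (Set.Icc a b ×ˢ Set.Icc a b) :=
    continuousOn_fst.prodMk (continuousOn_snd.prodMk
      ((continuousOn_pi.2 fun j =>
          continuousOn_prod_Icc_of_hasDerivAt (hy1 j) (hy2 j) (hy1c j)).prodMk
        (continuousOn_pi.2 fun j =>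
          (hr₁.continuousOn.mul (hy1c j)).prodMk (hr₂.continuousOn.mul (hy2c j)))))
  have hfd (e : ℝ × ℝ × (Fin m → ℝ) × (Fin m → ℝ × ℝ)) :
      ContinuousOn (fun q => fderiv ℝ Λ (z q) e) (Set.Icc a b ×ˢ Set.Icc a b) :=
    ((hL.continuous_fderiv one_ne_zero).comp_continuousOn hzc).clm_apply continuousOn_const
  refine conformable_eulerLagrange_of_weak hα0 hab
    (P := fun q => fderiv ℝ Λ (z q) (0, 0, Pi.single k (1 : ℝ), 0))
    (Q₁ := fun q => fderiv ℝ Λ (z q) (0, 0, 0, Pi.single k ((1 : ℝ), (0 : ℝ))))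
    (Q₂ := fun q => fderiv ℝ Λ (z q) (0, 0, 0, Pi.single k ((0 : ℝ), (1 : ℝ))))
    (D₁ := fun q => D1 k q.1 q.2) (D₂ := fun q => D2 k q.1 q.2)
    (hfd _) (hfd _) (hfd _) (hD1c k) (hD2c k) (hD1 k) (hD2 k) (fun g hg hsupp => ?_) hx₁ hx₂
  have hd := hg.continuous_fderiv one_ne_zero
  have hgd (q : ℝ × ℝ) : HasFDerivAt g (fderiv ℝ g q) q :=
    (hg.differentiable one_ne_zero).differentiableAt.hasFDerivAt
  have hg₁ : Continuous fun q => fderiv ℝ g q (1, 0) := hd.clm_apply continuous_const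
  have hg₂ : Continuous fun q => fderiv ℝ g q (0, 1) := hd.clm_apply continuous_const
  set h : ℝ × ℝ → ℝ × ℝ × (Fin m → ℝ) × (Fin m → ℝ × ℝ) := fun q =>
    g q • (0, 0, Pi.single k (1 : ℝ), 0)
      + ((q.1 - a) ^ (1 - α) * fderiv ℝ g q (1, 0)) • (0, 0, 0, Pi.single k ((1 : ℝ), (0 : ℝ)))
      + ((q.2 - a) ^ (1 - α) * fderiv ℝ g q (0, 1)) • (0, 0, 0, Pi.single k ((0 : ℝ), (1 : ℝ)))
    with hh
  have hhc : Continuous h :=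
    ((hg.continuous.smul continuous_const).add ((hr₁.mul hg₁).smul continuous_const)).add
      ((hr₂.mul hg₂).smul continuous_const)
  have hder := hasDerivAt_integral_lagrangian hK hK.measurableSet hμ hW hL hzc hhc.continuousOn
  have hvar' := hvar (fun j s t => (Pi.single k 1 : Fin m → ℝ) j * g (s, t))
    (fun j s t => (Pi.single k 1 : Fin m → ℝ) j * fderiv ℝ g (s, t) (1, 0))
    (fun j s t => (Pi.single k 1 : Fin m → ℝ) j * fderiv ℝ g (s, t) (0, 1))
    (fun j s _ t _ => ((hgd (s, t)).comp_hasDerivAt s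
      ((hasDerivAt_id s).prodMk (hasDerivAt_const s t))).const_mul _)
    (fun j s _ t _ => ((hgd (s, t)).comp_hasDerivAt t
      ((hasDerivAt_const t s).prodMk (hasDerivAt_id t))).const_mul _)
    (fun j => (continuous_const.mul hg₁).continuousOn)
    (fun j => (continuous_const.mul hg₂).continuousOn)
    (fun j s _ t _ hst => by
      refine mul_eq_zero_of_right _ (image_eq_zero_of_notMem_tsupport fun hmem => ?_)
      obtain ⟨⟨h₁, h₂⟩, h₃, h₄⟩ := hsupp hmem
      rcases hst with rfl | rfl | rfl | rfl
      exacts [lt_irrefl _ h₁, lt_irrefl _ h₂, lt_irrefl _ h₃, lt_irrefl _ h₄])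
  have hpath (ε : ℝ) (q : ℝ × ℝ) : z q + ε • h q =
      (q.1, q.2, fun j => y j q.1 q.2 + ε * ((Pi.single k 1 : Fin m → ℝ) j * g (q.1, q.2)),
        fun j => ((q.1 - a) ^ (1 - α) * y₁ j q.1 q.2 + ε * ((q.1 - a) ^ (1 - α)
            * ((Pi.single k 1 : Fin m → ℝ) j * fderiv ℝ g (q.1, q.2) (1, 0))),
          (q.2 - a) ^ (1 - α) * y₂ j q.1 q.2 + ε * ((q.2 - a) ^ (1 - α)
            * ((Pi.single k 1 : Fin m → ℝ) j * fderiv ℝ g (q.1, q.2) (0, 1))))) := by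
    ext j
    · simp [hz, hh]
    · simp [hz, hh]
    · simp [hz, hh, mul_comm]
    all_goals
      by_cases hj : j = k
      · subst hj
        simp [hz, hh]
      · simp [hz, hh, hj]
  have hJ (ε : ℝ) := intervalIntegral_intervalIntegral_eq_setIntegral hab.le
    (integrable_mul_of_continuousOn_isCompact hK hK.measurableSet hμ hW
      (hL.continuous.comp_continuousOn (hzc.add (hhc.continuousOn.const_smul ε))))
  have hzero := hder.unique (hvar'.congr_of_eventuallyEq (.of_forall fun ε => by
    refine (hJ ε).symm.trans ?_
    simp only [Function.comp_apply, hpath, Pi.add_apply, Pi.smul_apply, hΛ, mul_assoc]))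
  refine Eq.trans ?_ hzero
  congr 1 with q
  simp only [hh, map_add, map_smul, smul_eq_mul]
end

section
/- Necessary condition of invariance in the multi-dimensional case: let 0 < α < 1, a < b, R = [a,b]×[a,b], m ∈ ℕ, L : R×ℝ^m×ℝ^{2m} → ℝ of class C¹, and y = (y₁,…,y_m) : R → ℝ^m continuously differentiable, with conformable partials (∂^α_a y_k/∂x_i^α)(x) = (x_i−a)^{1−α}(∂y_k/∂x_i)(x). Let T₁, T₂, X₁, …, X_m : R → ℝ be continuously differentiable (the generators τ_i(x,y(x)), ξ_k(x,y(x)) along y) and let W : R → ℝ be given (playing the role of d^α Λ/dx^α for a Gauge term Λ). Fix x = (x₁,x₂) in the interior of R and suppose that the function ε ↦ L( x₁+εT₁(x), x₂+εT₂(x), y(x)+εX(x), (v_{k,i}(ε))_{k,i} ) · det M(ε) has derivative W(x) at ε = 0, where v_{k,i}(ε) = (∂^α_a y_k/∂x_i^α(x) + ε ∂^α_a X_k/∂x_i^α(x))·(x_i+εT_i(x)−a)^{1−α}/((x_i−a)^{1−α} + ε ∂^α_a T_i/∂x_i^α(x)) and M(ε) is the 2×2 matrix with entries M_{ij}(ε)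 = δ_{ij} + ε·(x_j−a)^{α−1}·(∂^α_a T_i/∂x_j^α)(x). Then Σ_{i=1}^2 (∂L/∂x_i)·T_i + Σ_{k=1}^m (∂L/∂y_k)·X_k + Σ_{k=1}^m Σ_{i=1}^2 (∂L/∂v_{k,i})·[ ∂^α_a X_k/∂x_i^α − (∂^α_a y_k/∂x_i^α)·( (α−1)T_i/(x_i−a) + (x_i−a)^{α−1}·∂^α_a T_i/∂x_i^α ) ] + L·[ (x₁−a)^{α−1}·∂^α_a T₁/∂x₁^α + (x₂−a)^{α−1}·∂^α_a T₂/∂x₂^α ] = W(x), with all partial derivatives of L evaluated at (x₁,x₂, y(x), ∂^α_a y/∂x^α(x)). -/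
/-- A linear functional on the jet space is the sum of its partial components. -/
lemma jet_clm_apply {m : ℕ} (D : ℝ × ℝ × (Fin m → ℝ) × (Fin m → ℝ × ℝ) →L[ℝ] ℝ)
    (t₁ t₂ : ℝ) (u v w : Fin m → ℝ) :
    D (t₁, t₂, u, fun k => (v k, w k)) =
      D (1, 0, 0, 0) * t₁ + D (0, 1, 0, 0) * t₂
      + (∑ k, D (0, 0, Pi.single k (1 : ℝ), 0) * u k)
      + (∑ k, D (0, 0, 0, Pi.single k ((1 : ℝ), (0 : ℝ))) * v k)
      + (∑ k, D (0, 0, 0, Pi.single k ((0 : ℝ), (1 : ℝ))) * w k) := by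
  have key : ((t₁, t₂, u, fun k => (v k, w k)) :
        ℝ × ℝ × (Fin m → ℝ) × (Fin m → ℝ × ℝ)) =
      t₁ • (1, 0, 0, 0) + t₂ • (0, 1, 0, 0)
      + (∑ k, u k • (0, 0, Pi.single k (1 : ℝ), 0))
      + (∑ k, v k • (0, 0, 0, Pi.single k ((1 : ℝ), (0 : ℝ))))
      + (∑ k, w k • (0, 0, 0, Pi.single k ((0 : ℝ), (1 : ℝ)))) := by
    ext <;> simp [Prod.fst_sum, Prod.snd_sum, Finset.sum_apply, Pi.single_apply, apply_ite]
  rw [key]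
  simp only [map_add, map_sum, map_smul, smul_eq_mul, mul_comm]

/-- First variation of a conformable derivative under an infinitesimal transformation. -/
lemma hasDerivAt_conformable_velocity {α a x : ℝ} (hx : a < x) (T dT dy dX : ℝ) :
    HasDerivAt (fun ε : ℝ =>
      ((x - a) ^ (1 - α) * dy + ε * ((x - a) ^ (1 - α) * dX))
        * (x + ε * T - a) ^ (1 - α)
        / ((x - a) ^ (1 - α) + ε * ((x - a) ^ (1 - α) * dT)))
      ((x - a) ^ (1 - α) * dX
        - (x - a) ^ (1 - α) * dy
          * ((α - 1) * T / (x - a) + (x - a) ^ (α - 1) * ((x - a) ^ (1 - α) * dT))) 0 := by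
  have hpos : 0 < x - a := sub_pos.2 hx
  have hp : (x - a) ^ (1 - α) ≠ 0 := (Real.rpow_pos_of_pos hpos _).ne'
  have hinv : (x - a) ^ (α - 1) = ((x - a) ^ (1 - α))⁻¹ := by
    rw [← Real.rpow_neg hpos.le, neg_sub]
  have hsub : (x - a) ^ (1 - α - 1) = (x - a) ^ (1 - α) / (x - a) := by
    rw [Real.rpow_sub_one hpos.ne']
  have affine (c d : ℝ) : HasDerivAt (fun ε : ℝ => c + ε * d) d 0 := by
    simpa using ((hasDerivAt_id (0 : ℝ)).mul_const d).const_add c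
  have hpow := ((affine x T).sub_const a).rpow_const (p := 1 - α)
    (Or.inl (by simpa using hpos.ne'))
  refine (((affine _ ((x - a) ^ (1 - α) * dX)).mul hpow).div
    (affine _ ((x - a) ^ (1 - α) * dT)) (by simpa using hp)).congr_deriv ?_
  simp only [zero_mul, add_zero, Pi.mul_apply]
  rw [hinv, hsub]
  field_simp
  ring

/-- The multi-dimensional Lagrangian `L(x₁,x₂,y,v)` as a function of one (product)
variable, so that its partial derivatives can be expressed via `fderiv`. -/
def uncurryL (m : ℕ) (L : ℝ → ℝ → (Fin m → ℝ) → (Fin m → ℝ × ℝ) → ℝ) :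
    ℝ × ℝ × (Fin m → ℝ) × (Fin m → ℝ × ℝ) → ℝ :=
  fun q => L q.1 q.2.1 q.2.2.1 q.2.2.2

/-- Necessary condition of invariance in the multi-dimensional case: if the conformable
multi-dimensional variational functional is invariant at the interior point
`x = (x₁,x₂)` under `x̄ᵢ = xᵢ + ετᵢ`, `ȳ_k = y_k + εξ_k` up to a Gauge term (with `W`
playing the role of `d^αΛ/dx^α` at `x`; the invariance identity up to `o(ε)` is
expressed as a derivative-at-`0` condition on `Φ`), then
`Σᵢ (∂L/∂xᵢ)τᵢ + Σ_k (∂L/∂y_k)ξ_k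
 + Σ_{k,i} (∂L/∂v_{k,i})[∂^α_aξ_k/∂xᵢ^α − (∂^α_a y_k/∂xᵢ^α)((α−1)τᵢ/(xᵢ−a)
      + (xᵢ−a)^{α−1}∂^α_aτᵢ/∂xᵢ^α)]
 + L[(x₁−a)^{α−1}∂^α_aτ₁/∂x₁^α + (x₂−a)^{α−1}∂^α_aτ₂/∂x₂^α] = W`.
Here `T₁,T₂,X` are the generators along `y`, with ordinary partial derivatives
`dT i j = ∂τᵢ/∂x_j` and `dX1 k = ∂ξ_k/∂x₁`, `dX2 k = ∂ξ_k/∂x₂` at `x`, so that all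
conformable partials are `(x_j−a)^{1−α}` times the corresponding ordinary partials. -/
theorem multidim_conformable_invariance_necessary_condition
    (α a b : ℝ) (hα0 : 0 < α) (hα1 : α < 1) (hab : a < b) (m : ℕ)
    (L : ℝ → ℝ → (Fin m → ℝ) → (Fin m → ℝ × ℝ) → ℝ)
    (hL : ContDiff ℝ 1 (uncurryL m L))
    (x₁ x₂ : ℝ) (hx₁ : x₁ ∈ Set.Ioo a b) (hx₂ : x₂ ∈ Set.Ioo a b)
    (y : Fin m → ℝ → ℝ → ℝ) (dy1 dy2 : Fin m → ℝ)
    (hy1 : ∀ k, HasDerivAt (fun t => y k t x₂) (dy1 k) x₁)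
    (hy2 : ∀ k, HasDerivAt (fun t => y k x₁ t) (dy2 k) x₂)
    (T₁ T₂ : ℝ → ℝ → ℝ) (dT11 dT12 dT21 dT22 : ℝ)
    (hT11 : HasDerivAt (fun t => T₁ t x₂) dT11 x₁)
    (hT12 : HasDerivAt (fun t => T₁ x₁ t) dT12 x₂)
    (hT21 : HasDerivAt (fun t => T₂ t x₂) dT21 x₁)
    (hT22 : HasDerivAt (fun t => T₂ x₁ t) dT22 x₂)
    (X : Fin m → ℝ → ℝ → ℝ) (dX1 dX2 : Fin m → ℝ)
    (hX1 : ∀ k, HasDerivAt (fun t => X k t x₂) (dX1 k) x₁)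
    (hX2 : ∀ k, HasDerivAt (fun t => X k x₁ t) (dX2 k) x₂)
    (W : ℝ)
    (hinv : HasDerivAt (fun ε : ℝ =>
      L (x₁ + ε * T₁ x₁ x₂) (x₂ + ε * T₂ x₁ x₂)
        (fun k => y k x₁ x₂ + ε * X k x₁ x₂)
        (fun k =>
          (((x₁ - a) ^ (1 - α) * dy1 k + ε * ((x₁ - a) ^ (1 - α) * dX1 k))
              * (x₁ + ε * T₁ x₁ x₂ - a) ^ (1 - α)
              / ((x₁ - a) ^ (1 - α) + ε * ((x₁ - a) ^ (1 - α) * dT11)),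
           ((x₂ - a) ^ (1 - α) * dy2 k + ε * ((x₂ - a) ^ (1 - α) * dX2 k))
              * (x₂ + ε * T₂ x₁ x₂ - a) ^ (1 - α)
              / ((x₂ - a) ^ (1 - α) + ε * ((x₂ - a) ^ (1 - α) * dT22))))
        * ((1 + ε * ((x₁ - a) ^ (α - 1) * ((x₁ - a) ^ (1 - α) * dT11)))
            * (1 + ε * ((x₂ - a) ^ (α - 1) * ((x₂ - a) ^ (1 - α) * dT22)))
          - (ε * ((x₂ - a) ^ (α - 1) * ((x₂ - a) ^ (1 - α) * dT12)))
            * (ε * ((x₁ - a) ^ (α - 1) * ((x₁ - a) ^ (1 - α) * dT21))))) W 0) :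
    fderiv ℝ (uncurryL m L)
        (x₁, x₂, fun k => y k x₁ x₂,
          fun k => ((x₁ - a) ^ (1 - α) * dy1 k, (x₂ - a) ^ (1 - α) * dy2 k))
        (1, 0, 0, 0) * T₁ x₁ x₂
    + fderiv ℝ (uncurryL m L)
        (x₁, x₂, fun k => y k x₁ x₂,
          fun k => ((x₁ - a) ^ (1 - α) * dy1 k, (x₂ - a) ^ (1 - α) * dy2 k))
        (0, 1, 0, 0) * T₂ x₁ x₂
    + (∑ k, fderiv ℝ (uncurryL m L)
        (x₁, x₂, fun k => y k x₁ x₂,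
          fun k => ((x₁ - a) ^ (1 - α) * dy1 k, (x₂ - a) ^ (1 - α) * dy2 k))
        (0, 0, Pi.single k (1 : ℝ), 0) * X k x₁ x₂)
    + (∑ k, fderiv ℝ (uncurryL m L)
        (x₁, x₂, fun k => y k x₁ x₂,
          fun k => ((x₁ - a) ^ (1 - α) * dy1 k, (x₂ - a) ^ (1 - α) * dy2 k))
        (0, 0, 0, Pi.single k ((1 : ℝ), (0 : ℝ)))
        * ((x₁ - a) ^ (1 - α) * dX1 k
          - (x₁ - a) ^ (1 - α) * dy1 k
            * ((α - 1) * T₁ x₁ x₂ / (x₁ - a)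
              + (x₁ - a) ^ (α - 1) * ((x₁ - a) ^ (1 - α) * dT11))))
    + (∑ k, fderiv ℝ (uncurryL m L)
        (x₁, x₂, fun k => y k x₁ x₂,
          fun k => ((x₁ - a) ^ (1 - α) * dy1 k, (x₂ - a) ^ (1 - α) * dy2 k))
        (0, 0, 0, Pi.single k ((0 : ℝ), (1 : ℝ)))
        * ((x₂ - a) ^ (1 - α) * dX2 k
          - (x₂ - a) ^ (1 - α) * dy2 k
            * ((α - 1) * T₂ x₁ x₂ / (x₂ - a)
              + (x₂ - a) ^ (α - 1) * ((x₂ - a) ^ (1 - α) * dT22))))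
    + L x₁ x₂ (fun k => y k x₁ x₂)
        (fun k => ((x₁ - a) ^ (1 - α) * dy1 k, (x₂ - a) ^ (1 - α) * dy2 k))
        * ((x₁ - a) ^ (α - 1) * ((x₁ - a) ^ (1 - α) * dT11)
          + (x₂ - a) ^ (α - 1) * ((x₂ - a) ^ (1 - α) * dT22)) = W := by
  have hp₁ : (x₁ - a) ^ (1 - α) ≠ 0 :=
    (Real.rpow_pos_of_pos (sub_pos.2 hx₁.1) _).ne'
  have hp₂ : (x₂ - a) ^ (1 - α) ≠ 0 :=
    (Real.rpow_pos_of_pos (sub_pos.2 hx₂.1) _).ne'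
  have affine (c d : ℝ) : HasDerivAt (fun ε : ℝ => c + ε * d) d 0 := by
    simpa using ((hasDerivAt_id (0 : ℝ)).mul_const d).const_add c
  have linear (d : ℝ) : HasDerivAt (fun ε : ℝ => ε * d) d 0 := by
    simpa using (hasDerivAt_id (0 : ℝ)).mul_const d
  have hcurve := (affine x₁ (T₁ x₁ x₂)).prodMk ((affine x₂ (T₂ x₁ x₂)).prodMk
    ((hasDerivAt_pi.2 fun k => affine (y k x₁ x₂) (X k x₁ x₂)).prodMk
      (hasDerivAt_pi.2 fun k =>
        (hasDerivAt_conformable_velocity (α := α) hx₁.1 (T₁ x₁ x₂) dT11 (dy1 k) (dX1 k)).prodMk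
          (hasDerivAt_conformable_velocity (α := α) hx₂.1 (T₂ x₁ x₂) dT22 (dy2 k) (dX2 k)))))
  have hD := (hL.differentiable one_ne_zero (x₁, x₂, fun k => y k x₁ x₂,
    fun k => ((x₁ - a) ^ (1 - α) * dy1 k, (x₂ - a) ^ (1 - α) * dy2 k))).hasFDerivAt
  have hLcurve := hD.comp_hasDerivAt_of_eq (0 : ℝ) hcurve (by simp [hp₁, hp₂])
  have hdet :=
    ((affine 1 ((x₁ - a) ^ (α - 1) * ((x₁ - a) ^ (1 - α) * dT11))).mul
      (affine 1 ((x₂ - a) ^ (α - 1) * ((x₂ - a) ^ (1 - α) * dT22)))).sub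
    ((linear ((x₂ - a) ^ (α - 1) * ((x₂ - a) ^ (1 - α) * dT12))).mul
      (linear ((x₁ - a) ^ (α - 1) * ((x₁ - a) ^ (1 - α) * dT21))))
  have hW := (hLcurve.mul hdet).unique hinv
  rw [jet_clm_apply] at hW
  rw [← hW]
  simp [uncurryL, hp₁, hp₂]
end
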